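/- arXiv:math/0411308 — 2 statements merged into one kernel-verified Lean document; each statement's English description precedes it below -/
import Mathlib

section
/- Let W ⊂ ℂⁿ be a uniformly flat smooth closed complex hypersurface. Then for each R > 0 there is a constant C_R > 0 such that for all z ∈ ℂⁿ, the area of W ∩ B(z,R) satisfies σ(W ∩ B(z,R)) ≤ C_R, where σ is the surface measure on W. -/
open MeasureTheory Metric Set
open scoped ENNReal NNReal Topology

noncomputable section

/-- `ℂⁿ` with the Euclidean (Hermitian) norm. -/
abbrev En (n : ℕ) : Type := EuclideanSpace ℂ (Fin n)

instance (n : ℕ) : MeasurableSpace (En n) := borel _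
instance (n : ℕ) : BorelSpace (En n) := ⟨rfl⟩

/-- Lebesgue measure on `ℂⁿ ≅ ℝ^{2n}`, realized as `2n`-dimensional Hausdorff measure. -/
def vol (n : ℕ) : Measure (En n) := μH[(2 * n : ℝ)]

/-- The surface measure `dσ` on a hypersurface `W` induced by `ω^{n-1}`:
a constant multiple of `(2n-2)`-dimensional Hausdorff measure restricted to `W`. -/
def surf (n : ℕ) (W : Set (En n)) : Measure (En n) :=
  ((2 : ℝ≥0∞) ^ (n - 1) * (Nat.factorial (n - 1) : ℝ≥0∞)) •
    (μH[(2 * n - 2 : ℝ)] : Measure (En n)).restrict W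

open Classical in
/-- The weighted `L^p`-"norm" (to the `p`-th power for `p < ∞`) of `F` over the set `S`
with respect to the measure `μ` and the weight `φ`; for `p = ∞` it is the weighted sup. -/
def wNorm {n : ℕ} (p : ℝ≥0∞) (φ : En n → ℝ) (μ : Measure (En n)) (S : Set (En n))
    (F : En n → ℂ) : ℝ≥0∞ :=
  if p = ⊤ then ⨆ z ∈ S, ENNReal.ofReal (‖F z‖ * Real.exp (-φ z))
  else ∫⁻ z in S, ENNReal.ofReal (‖F z‖ ^ p.toReal * Real.exp (-(p.toReal * φ z))) ∂μ

/-- Real Hessian of `φ` at `z` in the directions `u`, `v`. -/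
def hess {n : ℕ} (φ : En n → ℝ) (z u v : En n) : ℝ := fderiv ℝ (fderiv ℝ φ) z u v

/-- The Levi form `i∂∂̄φ(z)(v,v̄) = Σ φ_{j k̄}(z) v_j v̄_k`, expressed through the
real Hessian.  For `φ = ‖z‖²` it equals `‖v‖²`, i.e. `ω = i∂∂̄‖z‖²` corresponds to
`levi = ‖v‖²`. -/
def levi {n : ℕ} (φ : En n → ℝ) (z v : En n) : ℝ :=
  (hess φ z v v + hess φ z (Complex.I • v) (Complex.I • v)) / 4

/-- `W` is uniformly flat with tubular radius `ε₀`: the neighborhood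
`N_{ε₀}(W)` is a tubular neighborhood, i.e. every point of it has a unique nearest
point on `W` and the (smooth) nearest-point projection `pr` is well defined there. -/
def UniformlyFlatWith {n : ℕ} (ε₀ : ℝ) (W : Set (En n)) : Prop :=
  0 < ε₀ ∧ ∃ pr : En n → En n,
    ContDiffOn ℝ (⊤ : ℕ∞) pr {z | Metric.infDist z W < ε₀} ∧
    ∀ z : En n, Metric.infDist z W < ε₀ →
      pr z ∈ W ∧ dist z (pr z) = Metric.infDist z W ∧
        ∀ w ∈ W, dist z w = Metric.infDist z W → w = pr z

/-- `W` is uniformly flat. -/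
def UniformlyFlat {n : ℕ} (W : Set (En n)) : Prop := ∃ ε₀, UniformlyFlatWith ε₀ W

/-- `f` is holomorphic on the complex submanifold `W`: near every point of `W` it is
the restriction of some holomorphic function of the ambient space. -/
def HolOn {n : ℕ} (W : Set (En n)) (f : En n → ℂ) : Prop :=
  ∀ w ∈ W, ∃ U ∈ 𝓝 w, ∃ g : En n → ℂ, DifferentiableOn ℂ g U ∧ Set.EqOn f g (U ∩ W)

/-- The average `φ_r` of `φ` over the ball `B(z,r)`. -/
def avgBall {n : ℕ} (φ : En n → ℝ) (r : ℝ) (z : En n) : ℝ :=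
  ((vol n) (Metric.ball z r)).toReal⁻¹ * ∫ x in Metric.ball z r, φ x ∂(vol n)

/-- The averaged current of integration `Υ_W(z,r)(v,v̄)`: by Lelong–Poincaré,
`Υ_W(z,r)(v,v) = (π / vol B(z,r)) ∫_{W ∩ B(z,r)} |⟨v, n_w⟩|² dσ(w)`, where the unit
normal pairing is `|⟨v, n_w⟩| = ‖dT_w(v)‖ / ‖dT_w‖` for a defining function `T` of `W`. -/
def Upsilon {n : ℕ} (T : En n → ℂ) (W : Set (En n)) (r : ℝ) (z v : En n) : ℝ :=
  (Real.pi / ((vol n) (Metric.ball z r)).toReal) *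
    ∫ w in Metric.ball z r, (‖fderiv ℂ T w v‖ / ‖fderiv ℂ T w‖) ^ 2 ∂(surf n W)

theorem isOpen_setOf_infDist_lt {X : Type*} [PseudoMetricSpace X] (W : Set X) (ε : ℝ) :
    IsOpen {z | infDist z W < ε} :=
  isOpen_lt (continuous_infDist_pt W) continuous_const

section TubularProjection

open Asymptotics Filter
open scoped RealInnerProductSpace

variable {E : Type*} [NormedAddCommGroup E] [InnerProductSpace ℝ E]

/-- `pr` is a smooth nearest-point projection onto `W`, defined on the `ε`-neighbourhood of `W`. -/
structure IsTubularProjection (W : Set E) (ε : ℝ) (pr : E → E) : Prop where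
  pos : 0 < ε
  contDiffOn : ContDiffOn ℝ (⊤ : ℕ∞) pr {z | infDist z W < ε}
  mem : ∀ z, infDist z W < ε → pr z ∈ W
  dist_eq : ∀ z, infDist z W < ε → dist z (pr z) = infDist z W

/-- `Tan p` is the tangent space of `W` at each point `p` of `W`, in the sense that `W` is tangent
to `Tan p` to first order and conversely. -/
structure IsTangentField (W : Set E) (Tan : E → Submodule ℝ E) : Prop where
  inner_isLittleO : ∀ p ∈ W, ∀ ν ∈ (Tan p)ᗮ,
    (fun q => ⟪ν, q - p⟫) =o[𝓝[W] p] (fun q => q - p)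
  infDist_isLittleO : ∀ p ∈ W, ∀ u ∈ Tan p,
    (fun s : ℝ => infDist (p + s • u) W) =o[𝓝[>] 0] (fun s => s)

namespace IsTubularProjection

variable {W : Set E} {ε : ℝ} {pr : E → E}

theorem norm_sub (h : IsTubularProjection W ε pr) {z : E} (hz : infDist z W < ε) :
    ‖z - pr z‖ = infDist z W := by
  rw [← dist_eq_norm, h.dist_eq z hz]

theorem contDiffAt (h : IsTubularProjection W ε pr) {x : E} (hx : infDist x W < ε) :
    ContDiffAt ℝ (⊤ : ℕ∞) pr x :=
  h.contDiffOn.contDiffAt ((isOpen_setOf_infDist_lt W ε).mem_nhds hx)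

theorem hasFDerivAt (h : IsTubularProjection W ε pr) {x : E} (hx : infDist x W < ε) :
    HasFDerivAt pr (fderiv ℝ pr x) x :=
  ((h.contDiffAt hx).differentiableAt (by simp)).hasFDerivAt

/-- The gradient of half the squared distance is `x - pr x`. -/
theorem hasFDerivAt_infDist_sq (h : IsTubularProjection W ε pr) {x : E}
    (hx : infDist x W < ε) :
    HasFDerivAt (fun y => infDist y W ^ 2 / 2) (innerSL ℝ (x - pr x)) x := by
  rw [hasFDerivAt_iff_isLittleO, isLittleO_iff]
  intro c hc
  have hcont : ContinuousAt (fun y => ‖(y - pr y) - (x - pr x)‖ + ‖y - x‖) x := by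
    have := (h.hasFDerivAt hx).continuousAt
    fun_prop
  have hlt : ∀ᶠ y in 𝓝 x, ‖(y - pr y) - (x - pr x)‖ + ‖y - x‖ < c :=
    hcont.eventually_lt continuousAt_const (by simpa using hc)
  filter_upwards [hlt, (isOpen_setOf_infDist_lt W ε).mem_nhds hx] with y hy hyN
  have hyN : infDist y W < ε := hyN
  have h1 : infDist y W ≤ ‖(y - x) + (x - pr x)‖ := by
    have := infDist_le_dist_of_mem (x := y) (h.mem x hx)
    rwa [dist_eq_norm, ← sub_add_sub_cancel y x (pr x)] at this
  have h2 : infDist x W ≤ ‖(y - pr y) - (y - x)‖ := by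
    have := infDist_le_dist_of_mem (x := x) (h.mem y hyN)
    rwa [dist_eq_norm, show x - pr y = (y - pr y) - (y - x) by abel] at this
  have h1' := pow_le_pow_left₀ infDist_nonneg h1 2
  have h2' := pow_le_pow_left₀ infDist_nonneg h2 2
  rw [norm_add_sq_real] at h1'
  rw [norm_sub_sq_real, h.norm_sub hyN] at h2'
  rw [h.norm_sub hx] at h1'
  have h3 : ⟪(y - pr y) - (x - pr x), y - x⟫ ≥ -(‖(y - pr y) - (x - pr x)‖ * ‖y - x‖) :=
    (abs_le.1 (abs_real_inner_le_norm _ _)).1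
  rw [inner_sub_left] at h3
  rw [real_inner_comm] at h1'
  have h4 := mul_le_mul_of_nonneg_right hy.le (norm_nonneg (y - x))
  have h5 := mul_nonneg (norm_nonneg ((y - pr y) - (x - pr x))) (norm_nonneg (y - x))
  rw [innerSL_apply_apply, Real.norm_eq_abs, abs_le]
  constructor <;> nlinarith [norm_nonneg (y - x)]

theorem fderiv_apply_sub (h : IsTubularProjection W ε pr) {x : E} (hx : infDist x W < ε) :
    fderiv ℝ pr x (x - pr x) = 0 := by
  have hF : HasFDerivAt (fun y => y - pr y) (ContinuousLinearMap.id ℝ E - fderiv ℝ pr x) x :=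
    (hasFDerivAt_id x).sub (h.hasFDerivAt hx)
  have hev : ∀ᶠ y in 𝓝 x, HasFDerivAt (fun y => infDist y W ^ 2 / 2) (innerSL ℝ (y - pr y)) y := by
    filter_upwards [(isOpen_setOf_infDist_lt W ε).mem_nhds hx] with y hy
    exact h.hasFDerivAt_infDist_sq hy
  have hsym := second_derivative_symmetric_of_eventually hev
    ((innerSL ℝ (E := E)).hasFDerivAt.comp x hF)
  have hsq : HasFDerivAt (fun y => infDist y W ^ 2 / 2)
      ((innerSL ℝ (x - pr x)).comp (ContinuousLinearMap.id ℝ E - fderiv ℝ pr x)) x := by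
    have h1 := (hF.norm_sq).const_mul (1 / 2 : ℝ)
    have h2 : (fun y => infDist y W ^ 2 / 2) =ᶠ[𝓝 x] fun y => (1 / 2 : ℝ) * ‖y - pr y‖ ^ 2 := by
      filter_upwards [(isOpen_setOf_infDist_lt W ε).mem_nhds hx] with y hy
      rw [h.norm_sub hy]
      ring
    refine (h1.congr_of_eventuallyEq h2).congr_fderiv ?_
    ext v
    simp
  have huniq := hsq.unique (h.hasFDerivAt_infDist_sq hx)
  refine ext_inner_right ℝ fun v => ?_
  have e1 : ⟪x - pr x - fderiv ℝ pr x (x - pr x), v⟫ = ⟪v - fderiv ℝ pr x v, x - pr x⟫ :=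
    hsym (x - pr x) v
  have e2 : ⟪x - pr x, v - fderiv ℝ pr x v⟫ = ⟪x - pr x, v⟫ := DFunLike.congr_fun huniq v
  rw [inner_sub_left, real_inner_comm (x - pr x) (v - fderiv ℝ pr x v), e2,
    real_inner_comm] at e1
  rw [inner_zero_left]
  linarith

theorem apply_ray (h : IsTubularProjection W ε pr) {x : E} (hx : infDist x W < ε) {t : ℝ}
    (ht : 0 ≤ t) (htε : (1 + t) * ‖x - pr x‖ < ε) :
    pr (x + t • (x - pr x)) = pr x := by
  set ξ := x - pr x with hξ
  have hN : ∀ s ∈ Icc 0 t, infDist (x + s • ξ) W < ε := fun s hs => by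
    have h1 := infDist_le_dist_of_mem (x := x + s • ξ) (h.mem x hx)
    have h2 : x + s • ξ - pr x = (1 + s) • ξ := by rw [hξ]; module
    rw [dist_eq_norm, h2, norm_smul, Real.norm_of_nonneg (by linarith [hs.1])] at h1
    have := mul_le_mul_of_nonneg_right (add_le_add_right hs.2 1) (norm_nonneg ξ)
    linarith
  have hline : ∀ s : ℝ, HasDerivAt (fun s : ℝ => x + s • ξ) ξ s := fun s => by
    simpa using ((hasDerivAt_id s).smul_const ξ).const_add x
  have hcont : ContinuousOn (fun s => ‖fderiv ℝ pr (x + s • ξ)‖) (Icc 0 t) := by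
    refine ContinuousOn.norm ?_
    have := h.contDiffOn.continuousOn_fderiv_of_isOpen (isOpen_setOf_infDist_lt W ε) (by simp)
    exact this.comp (by fun_prop) hN
  obtain ⟨M, hM⟩ := (isCompact_Icc.image_of_continuousOn hcont).bddAbove
  have hG : ∀ s ∈ Icc 0 t, HasDerivAt (fun s => pr (x + s • ξ) - pr x)
      (fderiv ℝ pr (x + s • ξ) ξ) s := fun s hs =>
    ((h.hasFDerivAt (hN s hs)).comp_hasDerivAt s (hline s)).sub_const _
  have key := eq_zero_of_abs_deriv_le_mul_abs_self_of_eq_zero_right (K := M)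
    (fun s hs => (hG s hs).continuousAt.continuousWithinAt)
    (fun s hs => (hG s (Ico_subset_Icc_self hs)).hasDerivWithinAt) (by simp)
    (fun s hs => ?_) t (right_mem_Icc.2 ht)
  · exact sub_eq_zero.1 key
  · have hs' := Ico_subset_Icc_self hs
    have h0 := h.fderiv_apply_sub (hN s hs')
    have hpos : 0 < 1 + s := by linarith [hs.1]
    have h1 : (1 + s) • fderiv ℝ pr (x + s • ξ) ξ
        = fderiv ℝ pr (x + s • ξ) (pr (x + s • ξ) - pr x) := by
      rw [← map_smul, ← zero_add (fderiv ℝ pr (x + s • ξ) (pr (x + s • ξ) - pr x)), ← h0, ← map_add]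
      congr 1
      rw [hξ]; module
    have h2 : ‖fderiv ℝ pr (x + s • ξ) ξ‖ ≤ ‖(1 + s) • fderiv ℝ pr (x + s • ξ) ξ‖ := by
      rw [norm_smul, Real.norm_of_nonneg hpos.le]
      nlinarith [norm_nonneg (fderiv ℝ pr (x + s • ξ) ξ), hs.1]
    rw [h1] at h2
    exact h2.trans ((ContinuousLinearMap.le_opNorm _ _).trans
      (mul_le_mul_of_nonneg_right (hM (mem_image_of_mem _ hs')) (norm_nonneg _)))

theorem inner_sub_le (h : IsTubularProjection W ε pr) {x q : E} (hx : infDist x W < ε)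
    (hq : q ∈ W) :
    ⟪x - pr x, q - pr x⟫ ≤ ‖x - pr x‖ * ‖q - pr x‖ ^ 2 / (2 * ε) := by
  have hε := h.pos
  set ξ := x - pr x with hξ
  rcases (norm_nonneg ξ).eq_or_lt with h0 | h0
  · rw [norm_eq_zero.1 h0.symm]
    simp
  rw [le_div_iff₀ (by positivity)]
  have hlt : ‖ξ‖ < ε := by rwa [hξ, h.norm_sub hx]
  have key : ∀ r ∈ Ioo ‖ξ‖ ε, ⟪ξ, q - pr x⟫ * (2 * r) ≤ ‖ξ‖ * ‖q - pr x‖ ^ 2 := by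
    intro r hr
    have hrpos : 0 < r := h0.trans hr.1
    have hray := h.apply_ray hx (t := r / ‖ξ‖ - 1)
      (by rw [sub_nonneg, le_div_iff₀ h0]; linarith [hr.1])
      (by rw [← hξ]; field_simp; linarith [hr.2])
    have hy : x + (r / ‖ξ‖ - 1) • (x - pr x) = pr x + (r / ‖ξ‖) • ξ := by rw [hξ]; module
    rw [hy] at hray
    have hnorm : ‖(r / ‖ξ‖) • ξ‖ = r := by
      rw [norm_smul, Real.norm_of_nonneg (by positivity)]; field_simp
    have hyN : infDist (pr x + (r / ‖ξ‖) • ξ) W < ε := by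
      have := infDist_le_dist_of_mem (x := pr x + (r / ‖ξ‖) • ξ) (h.mem x hx)
      rw [dist_eq_norm, add_sub_cancel_left, hnorm] at this
      exact this.trans_lt hr.2
    have hd := h.norm_sub hyN
    rw [hray, add_sub_cancel_left, hnorm] at hd
    have hle := infDist_le_dist_of_mem (x := pr x + (r / ‖ξ‖) • ξ) hq
    rw [← hd, dist_eq_norm, ← norm_neg, show -(pr x + (r / ‖ξ‖) • ξ - q)
      = (q - pr x) - (r / ‖ξ‖) • ξ by module] at hle
    have hsq := pow_le_pow_left₀ hrpos.le hle 2
    rw [norm_sub_sq_real, hnorm, inner_smul_right, real_inner_comm] at hsq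
    have : 2 * (r / ‖ξ‖ * ⟪ξ, q - pr x⟫) ≤ ‖q - pr x‖ ^ 2 := by linarith
    have := mul_le_mul_of_nonneg_left this h0.le
    have e : ‖ξ‖ * (2 * (r / ‖ξ‖ * ⟪ξ, q - pr x⟫)) = ⟪ξ, q - pr x⟫ * (2 * r) := by
      field_simp
    linarith
  have hc : Tendsto (fun r : ℝ => ⟪ξ, q - pr x⟫ * (2 * r)) (𝓝[<] ε)
      (𝓝 (⟪ξ, q - pr x⟫ * (2 * ε))) :=
    tendsto_nhdsWithin_of_tendsto_nhds (Continuous.tendsto (by fun_prop) ε)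
  refine le_of_tendsto hc ?_
  filter_upwards [Ioo_mem_nhdsLT hlt] with r hr using key r hr

theorem apply_eq_self (h : IsTubularProjection W ε pr) {p : E} (hp : p ∈ W) : pr p = p := by
  have h0 : infDist p W = 0 := infDist_zero_of_mem hp
  have := h.norm_sub (z := p) (by rw [h0]; exact h.pos)
  rw [h0, norm_sub_eq_zero_iff] at this
  exact this.symm

variable {Tan : E → Submodule ℝ E}

theorem inner_le_of_mem_orthogonal (h : IsTubularProjection W ε pr) (hT : IsTangentField W Tan)
    {p q ν : E} (hp : p ∈ W) (hν : ν ∈ (Tan p)ᗮ) (hq : q ∈ W) :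
    ⟪ν, q - p⟫ ≤ ‖ν‖ * ‖q - p‖ ^ 2 / (2 * ε) := by
  have hε := h.pos
  have hline : Tendsto (fun s : ℝ => p + s • ν) (𝓝[>] 0) (𝓝 p) := by
    refine tendsto_nhdsWithin_of_tendsto_nhds ?_
    have : Continuous fun s : ℝ => p + s • ν := by fun_prop
    simpa using this.tendsto 0
  have hpN : infDist p W < ε := by rw [infDist_zero_of_mem hp]; exact hε
  have hN : ∀ᶠ s : ℝ in 𝓝[>] 0, infDist (p + s • ν) W < ε :=
    hline.eventually ((isOpen_setOf_infDist_lt W ε).mem_nhds hpN)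
  have hP : Tendsto (fun s : ℝ => pr (p + s • ν)) (𝓝[>] 0) (𝓝 p) := by
    have := (h.hasFDerivAt hpN).continuousAt.tendsto.comp hline
    rwa [h.apply_eq_self hp] at this
  have hPW : Tendsto (fun s : ℝ => pr (p + s • ν)) (𝓝[>] 0) (𝓝[W] p) :=
    tendsto_nhdsWithin_iff.2 ⟨hP, hN.mono fun s hs => h.mem _ hs⟩
  have ho : (fun s : ℝ => pr (p + s • ν) - p) =o[𝓝[>] 0] (fun s : ℝ => s) := by
    rw [isLittleO_iff]
    intro c hc
    have h1 := ((hT.inner_isLittleO p hp ν hν).comp_tendsto hPW).bound (half_pos hc)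
    filter_upwards [h1, hN, self_mem_nhdsWithin] with s h1 hN hs
    have hs : 0 < s := hs
    simp only [Function.comp_apply, Real.norm_eq_abs] at h1
    have h2 := infDist_le_dist_of_mem (x := p + s • ν) hp
    rw [← h.norm_sub hN, dist_eq_norm, add_sub_cancel_left,
      show p + s • ν - pr (p + s • ν) = s • ν - (pr (p + s • ν) - p) by abel] at h2
    have h3 := pow_le_pow_left₀ (norm_nonneg _) h2 2
    rw [norm_sub_sq_real, inner_smul_left] at h3
    simp only [conj_trivial] at h3
    set D := pr (p + s • ν) - p
    have h4 : ‖D‖ * ‖D‖ ≤ (c * s) * ‖D‖ := by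
      have := mul_le_mul_of_nonneg_left ((le_abs_self _).trans h1) hs.le
      nlinarith
    rw [Real.norm_of_nonneg hs.le]
    rcases (norm_nonneg D).eq_or_lt with h0 | h0
    · rw [← h0]; positivity
    · exact le_of_mul_le_mul_right h4 h0
  have hn : Tendsto (fun s : ℝ => ν - s⁻¹ • (pr (p + s • ν) - p)) (𝓝[>] 0) (𝓝 ν) := by
    have := ho.tendsto_inv_smul_nhds_zero
    simpa using this.const_sub ν
  refine le_of_tendsto_of_tendsto (hn.inner (hP.const_sub q))
    ((hn.norm.mul ((hP.const_sub q).norm.pow 2)).div_const (2 * ε)) ?_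
  filter_upwards [hN, self_mem_nhdsWithin] with s hN hs
  have hs : 0 < s := hs
  have h1 := h.inner_sub_le hN hq
  have h2 : p + s • ν - pr (p + s • ν) = s • (ν - s⁻¹ • (pr (p + s • ν) - p)) := by
    rw [smul_sub, smul_inv_smul₀ hs.ne']; abel
  rw [h2, inner_smul_left, norm_smul, Real.norm_of_nonneg hs.le] at h1
  simp only [conj_trivial] at h1
  rw [mul_assoc, mul_div_assoc] at h1
  exact le_of_mul_le_mul_left h1 hs

theorem sub_mem_orthogonal (h : IsTubularProjection W ε pr) (hT : IsTangentField W Tan)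
    {x : E} (hx : infDist x W < ε) : x - pr x ∈ (Tan (pr x))ᗮ := by
  have key : ∀ u ∈ Tan (pr x), ⟪x - pr x, u⟫ ≤ 0 := by
    intro u hu
    by_contra! ha
    set n := x - pr x with hn
    have hn0 : 0 < ‖n‖ := by
      refine norm_pos_iff.2 fun h0 => ?_
      rw [h0, inner_zero_left] at ha
      exact lt_irrefl _ ha
    set c := ⟪n, u⟫ / (2 * ‖n‖) with hc
    have hcpos : 0 < c := by positivity
    have e1 := (hT.infDist_isLittleO _ (h.mem x hx) u hu).bound hcpos
    have e2 : ∀ᶠ s : ℝ in 𝓝[>] 0, c * s < ‖n‖ :=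
      nhdsWithin_le_nhds ((continuous_const_mul c).continuousAt.eventually_lt
        continuousAt_const (by simpa using hn0))
    have e3 : ∀ᶠ s : ℝ in 𝓝[>] 0, s * ‖u‖ ^ 2 < ⟪n, u⟫ :=
      nhdsWithin_le_nhds ((continuous_mul_const (‖u‖ ^ 2)).continuousAt.eventually_lt
        continuousAt_const (by simpa using ha))
    obtain ⟨s, ⟨⟨h1, h2⟩, h3⟩, hs⟩ := (((e1.and e2).and e3).and self_mem_nhdsWithin).exists
    have hs : 0 < s := hs
    rw [Real.norm_of_nonneg infDist_nonneg, Real.norm_of_nonneg hs.le] at h1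
    have h4 := infDist_le_infDist_add_dist (s := W) (x := x) (y := pr x + s • u)
    rw [← h.norm_sub hx, dist_eq_norm, ← hn,
      show x - (pr x + s • u) = n - s • u by rw [hn]; abel] at h4
    have h5 : ‖n‖ - c * s ≤ ‖n - s • u‖ := by linarith
    have h6 := pow_le_pow_left₀ (by linarith) h5 2
    rw [norm_sub_sq_real, inner_smul_right, norm_smul, Real.norm_of_nonneg hs.le] at h6
    have h7 : c * (2 * ‖n‖) = ⟪n, u⟫ := by rw [hc]; field_simp
    have h8 : s * ⟪n, u⟫ ≤ s * (s * ‖u‖ ^ 2) := by nlinarith [sq_nonneg (c * s)]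
    have := le_of_mul_le_mul_left h8 hs
    linarith
  rw [Submodule.mem_orthogonal']
  intro u hu
  have h1 := key u hu
  have h2 := key (-u) (neg_mem hu)
  rw [inner_neg_right] at h2
  linarith

theorem infDist_add_smul_le (h : IsTubularProjection W ε pr) (hT : IsTangentField W Tan)
    {q u : E} (hq : q ∈ W) (hu : u ∈ Tan q) (hu1 : ‖u‖ = 1) {t : ℝ} (ht : 0 < t) (htε : t < ε) :
    infDist (q + t • u) W ≤ 3 * t ^ 2 / ε := by
  classical
  have hε := h.pos
  have hdist : ∀ s : ℝ, 0 ≤ s → infDist (q + s • u) W ≤ s := fun s hs => by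
    simpa [dist_eq_norm, norm_smul, hu1, abs_of_nonneg hs] using
      infDist_le_dist_of_mem (x := q + s • u) hq
  have key : ∀ η > 0, infDist (q + t • u) W ≤ t * (η + 3 * t / ε) := by
    intro η hη
    have e1 := (hT.infDist_isLittleO q hq u hu).bound hη
    obtain ⟨a, h1, ha0, hat⟩ := (e1.and (Ioo_mem_nhdsGT ht)).exists
    rw [Real.norm_of_nonneg infDist_nonneg, Real.norm_of_nonneg ha0.le] at h1
    set n : ℝ → E := fun s => q + s • u - pr (q + s • u) with hn
    have hN : ∀ s ∈ Ico a t, infDist (q + s • u) W < ε := fun s hs =>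
      (hdist s (ha0.le.trans hs.1)).trans_lt (hs.2.trans htε)
    have hnorm : ∀ s ∈ Ico a t, infDist (q + s • u) W = ‖n s‖ := fun s hs =>
      (h.norm_sub (hN s hs)).symm
    refine image_le_of_liminf_slope_right_lt_deriv_boundary
      (f := fun s => infDist (q + s • u) W) (B := fun s => s * (η + 3 * s / ε))
      (f' := fun s => if n s = 0 then 1 else ⟪n s, u⟫ / ‖n s‖)
      (B' := fun s => η + 6 * s / ε) (a := a) (b := t)
      ?_ ?_ ?_ ?_ ?_ (right_mem_Icc.2 hat.le)
    · exact ((continuous_infDist_pt W).comp (by fun_prop)).continuousOn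
    · intro s hs r hr
      have hs' := hnorm s hs
      have hle : ∀ z, infDist (q + z • u) W ≤ ‖n s + (z - s) • u‖ := fun z => by
        have := infDist_le_dist_of_mem (x := q + z • u) (h.mem _ (hN s hs))
        rwa [dist_eq_norm, show q + z • u - pr (q + s • u) = n s + (z - s) • u by
          simp only [hn]; module] at this
      refine Eventually.frequently ?_
      split_ifs at hr with h0
      · filter_upwards [self_mem_nhdsWithin] with z hz
        have hz : 0 < z - s := sub_pos.2 hz
        have h2 := hle z
        rw [h0, zero_add, norm_smul, hu1, mul_one, Real.norm_of_nonneg hz.le] at h2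
        rw [h0, norm_zero] at hs'
        rw [slope_def_field, hs', div_lt_iff₀ hz]
        nlinarith
      · have hn0 : 0 < ‖n s‖ := norm_pos_iff.2 h0
        have hc : ContinuousAt (fun z => ⟪n s, u⟫ / ‖n s‖ + (z - s) / (2 * ‖n s‖)) s := by
          fun_prop
        have hev := hc.eventually_lt continuousAt_const (by simpa using hr)
        filter_upwards [self_mem_nhdsWithin, nhdsWithin_le_nhds hev] with z hz hzr
        have hz : 0 < z - s := sub_pos.2 hz
        refine lt_of_le_of_lt ?_ hzr
        rw [slope_def_field, hs', div_le_iff₀ hz]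
        have h2 := norm_add_sq_real (n s) ((z - s) • u)
        rw [norm_smul, hu1, mul_one, Real.norm_of_nonneg hz.le, inner_smul_right] at h2
        have h3 : (⟪n s, u⟫ / ‖n s‖ + (z - s) / (2 * ‖n s‖)) * (z - s)
            = (‖n s + (z - s) • u‖ ^ 2 - ‖n s‖ ^ 2) / (2 * ‖n s‖) := by
          rw [h2]; field_simp; ring
        rw [h3, le_div_iff₀ (by positivity)]
        have h4 := hle z
        nlinarith [sq_nonneg (‖n s + (z - s) • u‖ - ‖n s‖)]
    · have : 0 ≤ a * (3 * a / ε) := by positivity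
      linarith
    · intro s
      have := (hasDerivAt_id s).mul (((hasDerivAt_id s).const_mul 3).div_const ε |>.const_add η)
      refine this.congr_deriv ?_
      simp only [id]
      field_simp
      ring
    · intro s hs heq
      have hspos : 0 < s := ha0.trans_le hs.1
      have hs' := hnorm s hs
      have hn0 : 0 < ‖n s‖ := by rw [← hs', heq]; positivity
      rw [if_neg (norm_pos_iff.1 hn0), div_lt_iff₀ hn0]
      have h2 := h.inner_le_of_mem_orthogonal hT (h.mem _ (hN s hs))
        (neg_mem (h.sub_mem_orthogonal hT (hN s hs))) hq
      have h3 : q - pr (q + s • u) = n s - s • u := by rw [hn]; module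
      change ⟪-n s, _⟫ ≤ ‖-n s‖ * _ / _ at h2
      rw [h3, norm_neg, inner_neg_left, inner_sub_right, inner_smul_right,
        real_inner_self_eq_norm_sq] at h2
      have h4 : ‖n s - s • u‖ ≤ 2 * s := by
        have := norm_sub_le (n s) (s • u)
        rw [norm_smul, hu1, mul_one, Real.norm_of_nonneg hspos.le, ← hs'] at this
        linarith [hdist s hspos.le]
      have h5 := mul_le_mul_of_nonneg_left (pow_le_pow_left₀ (norm_nonneg _) h4 2) hn0.le
      have h6 : ‖n s‖ * ‖n s - s • u‖ ^ 2 / (2 * ε) ≤ ‖n s‖ * (2 * s ^ 2 / ε) := by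
        rw [div_le_iff₀ (by positivity)]
        refine h5.trans_eq ?_
        field_simp
      have h7 : s * ⟪n s, u⟫ ≤ ‖n s‖ * (s * (η + 3 * s / ε)) + ‖n s‖ * (2 * s ^ 2 / ε) := by
        rw [← heq, hs']; nlinarith
      have h8 : ‖n s‖ * (s * (η + 3 * s / ε)) + ‖n s‖ * (2 * s ^ 2 / ε)
          < s * ((η + 6 * s / ε) * ‖n s‖) := by
        have : 0 < ‖n s‖ * (s ^ 2 / ε) := by positivity
        have e : s * ((η + 6 * s / ε) * ‖n s‖) - (‖n s‖ * (s * (η + 3 * s / ε))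
            + ‖n s‖ * (2 * s ^ 2 / ε)) = ‖n s‖ * (s ^ 2 / ε) := by
          field_simp; ring
        linarith
      exact lt_of_mul_lt_mul_left (h7.trans_lt h8) hspos.le
  refine le_of_forall_pos_le_add fun η hη => ?_
  refine (key (η / t) (by positivity)).trans_eq ?_
  field_simp
  ring

theorem inner_sub_le_half (h : IsTubularProjection W ε pr) (hT : IsTangentField W Tan)
    [FiniteDimensional ℝ E] {p q q' ν : E} (hp : p ∈ W) (hq : q ∈ W) (hq' : q' ∈ W)
    (hqp : dist q p ≤ ε / 100) (hqp' : dist q' p ≤ ε / 100) (hν : ν ∈ (Tan p)ᗮ) :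
    ⟪ν, q - q'⟫ ≤ 1 / 2 * ‖ν‖ * ‖q - q'‖ := by
  have hε := h.pos
  have hunit : ∀ u ∈ Tan q', ‖u‖ = 1 → ⟪ν, u⟫ ≤ 1 / 4 * ‖ν‖ := by
    intro u hu hu1
    have hlt : infDist (q' + (ε / 100) • u) W ≤ 3 * ε / 10000 := by
      refine (h.infDist_add_smul_le hT hq' hu hu1 (t := ε / 100) (by positivity)
        (by linarith)).trans_eq ?_
      field_simp
      norm_num
    have hN : infDist (q' + (ε / 100) • u) W < ε := by linarith
    have hw := h.mem _ hN
    have hd := h.norm_sub hN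
    set w := pr (q' + (ε / 100) • u)
    have hwp : ‖w - p‖ ≤ 3 * (ε / 100) := by
      have e : w - p = -(q' + (ε / 100) • u - w) + (ε / 100) • u + (q' - p) := by abel
      have hu' : ‖(ε / 100) • u‖ = ε / 100 := by
        rw [norm_smul, hu1, mul_one, Real.norm_of_nonneg (by positivity)]
      have h1 := norm_add₃_le (a := -(q' + (ε / 100) • u - w)) (b := (ε / 100) • u) (c := q' - p)
      rw [← e, norm_neg, hu'] at h1
      rw [dist_eq_norm] at hqp'
      linarith
    have h1 := h.inner_le_of_mem_orthogonal hT hp hν hw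
    have h2 := h.inner_le_of_mem_orthogonal hT hp (neg_mem hν) hq'
    have h3 : ⟪ν, q' + (ε / 100) • u - w⟫ ≤ ‖ν‖ * (3 * ε / 10000) :=
      (real_inner_le_norm _ _).trans
        (mul_le_mul_of_nonneg_left (hd.le.trans hlt) (norm_nonneg _))
    rw [norm_neg, inner_neg_left] at h2
    rw [dist_eq_norm] at hqp'
    have h1' : ‖ν‖ * ‖w - p‖ ^ 2 / (2 * ε) ≤ ‖ν‖ * (9 * ε / 20000) := by
      rw [div_le_iff₀ (by positivity)]
      have := mul_le_mul_of_nonneg_left (pow_le_pow_left₀ (norm_nonneg _) hwp 2) (norm_nonneg ν)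
      linarith
    have h2' : ‖ν‖ * ‖q' - p‖ ^ 2 / (2 * ε) ≤ ‖ν‖ * (ε / 20000) := by
      rw [div_le_iff₀ (by positivity)]
      have := mul_le_mul_of_nonneg_left (pow_le_pow_left₀ (norm_nonneg _) hqp' 2) (norm_nonneg ν)
      linarith
    have h4 : ⟪ν, (ε / 100) • u⟫
        = ⟪ν, q' + (ε / 100) • u - w⟫ + ⟪ν, w - p⟫ - ⟪ν, q' - p⟫ := by
      rw [← inner_add_right, ← inner_sub_right]
      congr 1
      abel
    rw [inner_smul_right] at h4
    have h5 : 0 ≤ ‖ν‖ * ε := by positivity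
    nlinarith
  have htan : ∀ u ∈ Tan q', ⟪ν, u⟫ ≤ 1 / 4 * ‖ν‖ * ‖u‖ := by
    intro u hu
    rcases (norm_nonneg u).eq_or_lt with h0 | h0
    · rw [norm_eq_zero.1 h0.symm]; simp
    have h1 := hunit (‖u‖⁻¹ • u) (Submodule.smul_mem _ _ hu)
      (by rw [norm_smul, norm_inv, norm_norm, inv_mul_cancel₀ h0.ne'])
    rwa [inner_smul_right, inv_mul_eq_div, div_le_iff₀ h0] at h1
  set v := q - q' with hv
  set u := (Tan q').starProjection v
  have hu : ‖u‖ ≤ ‖v‖ := (Tan q').norm_starProjection_apply_le v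
  have hm : v - u ∈ (Tan q')ᗮ := Submodule.sub_starProjection_mem_orthogonal v
  have huT : u ∈ Tan q' := Submodule.starProjection_apply_mem _ v
  have h1 := h.inner_le_of_mem_orthogonal hT hq' hm hq
  have hmm : ⟪v - u, v⟫ = ‖v - u‖ ^ 2 := by
    rw [← real_inner_self_eq_norm_sq, inner_sub_right (v - u) v u,
      Submodule.inner_left_of_mem_orthogonal huT hm, sub_zero]
  have hvε : ‖v‖ ≤ ε / 50 := by
    rw [hv, ← dist_eq_norm]
    have := dist_triangle_right q q' p
    linarith
  have hmle : ‖v - u‖ ≤ 1 / 100 * ‖v‖ := by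
    rw [← hv, hmm, le_div_iff₀ (by positivity)] at h1
    rcases (norm_nonneg (v - u)).eq_or_lt with h0 | h0
    · rw [← h0]; positivity
    have h2 : ‖v - u‖ * (2 * ε) ≤ ‖v‖ ^ 2 :=
      le_of_mul_le_mul_left (by linarith) h0
    have h3 : ‖v‖ ^ 2 ≤ ‖v‖ * (ε / 50) := by
      rw [sq]; exact mul_le_mul_of_nonneg_left hvε (norm_nonneg _)
    have h4 : ‖v - u‖ * (2 * ε) ≤ (1 / 100 * ‖v‖) * (2 * ε) := by linarith
    exact le_of_mul_le_mul_right h4 (by positivity)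
  have h2 : ⟪ν, v⟫ = ⟪ν, u⟫ + ⟪ν, v - u⟫ := by rw [← inner_add_right]; congr 1; abel
  have h3 := htan u huT
  have h4 := (real_inner_le_norm ν (v - u)).trans
    (mul_le_mul_of_nonneg_left hmle (norm_nonneg ν))
  have h5 := mul_le_mul_of_nonneg_left hu (norm_nonneg ν)
  have h6 : 0 ≤ ‖ν‖ * ‖v‖ := by positivity
  linarith

/-- Near a point `p` of `W`, orthogonal projection to the tangent space at `p` expands distances by
at most a factor `1 / 2`. -/
theorem norm_sub_le_two_mul (h : IsTubularProjection W ε pr) (hT : IsTangentField W Tan)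
    [FiniteDimensional ℝ E] {p q q' : E} (hp : p ∈ W) (hq : q ∈ W) (hq' : q' ∈ W)
    (hqp : dist q p ≤ ε / 100) (hqp' : dist q' p ≤ ε / 100) :
    ‖q - q'‖ ≤ 2 * ‖(Tan p).orthogonalProjectionOnto (q - q')‖ := by
  set v := q - q'
  change ‖v‖ ≤ 2 * ‖(Tan p).starProjection v‖
  set u := (Tan p).starProjection v
  have hm : v - u ∈ (Tan p)ᗮ := Submodule.sub_starProjection_mem_orthogonal v
  have huT : u ∈ Tan p := Submodule.starProjection_apply_mem _ v
  have h1 := h.inner_sub_le_half hT hp hq hq' hqp hqp' hm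
  have hmm : ⟪v - u, v⟫ = ‖v - u‖ ^ 2 := by
    rw [← real_inner_self_eq_norm_sq, inner_sub_right (v - u) v u,
      Submodule.inner_left_of_mem_orthogonal huT hm, sub_zero]
  have h2 : ‖v - u‖ ≤ 1 / 2 * ‖v‖ := by
    change ⟪v - u, v⟫ ≤ _ at h1
    rw [hmm] at h1
    rcases (norm_nonneg (v - u)).eq_or_lt with h0 | h0
    · rw [← h0]; positivity
    exact le_of_mul_le_mul_left (by linarith) h0
  have h3 := norm_add_le (v - u) u
  rw [sub_add_cancel] at h3
  linarith

variable [MeasurableSpace E] [BorelSpace E] [FiniteDimensional ℝ E]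

theorem exists_hausdorffMeasure_inter_ball_le_of_small (h : IsTubularProjection W ε pr)
    (hT : IsTangentField W Tan) {d : ℕ} (hd : ∀ p ∈ W, Module.finrank ℝ (Tan p) = d) :
    ∃ C : ℝ≥0∞, C ≠ ⊤ ∧ ∀ c : E, μH[d] (W ∩ ball c (ε / 200)) ≤ C := by
  have hε := h.pos
  let K : ℝ≥0 := (Fintype.card (Fin d) : ℝ≥0) ^ (1 / 2 : ℝ≥0∞).toReal * 2
  refine ⟨(K : ℝ≥0∞) ^ (d : ℝ) * ENNReal.ofReal ((2 * (ε / 100)) ^ d),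
    ENNReal.mul_ne_top (ENNReal.rpow_ne_top_of_nonneg (by positivity) ENNReal.coe_ne_top)
      ENNReal.ofReal_ne_top, fun c => ?_⟩
  rcases (W ∩ ball c (ε / 200)).eq_empty_or_nonempty with h0 | ⟨p, hp, hpc⟩
  · simp [h0]
  set S := W ∩ ball c (ε / 200)
  have hS : ∀ q ∈ S, q ∈ W ∧ dist q p ≤ ε / 100 := fun q hq => by
    have h1 := dist_triangle_right q p c
    have h2 := mem_ball.1 hq.2
    have h3 := mem_ball.1 hpc
    exact ⟨hq.1, by linarith⟩
  let b := (stdOrthonormalBasis ℝ (Tan p)).reindex (finCongr (hd p hp))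
  let f : E → Fin d → ℝ := fun x =>
    WithLp.ofLp (b.repr ((Tan p).orthogonalProjectionOnto x))
  have hanti : ∀ q ∈ S, ∀ q' ∈ S, dist q q' ≤ K * dist (f q) (f q') := by
    intro q hq q' hq'
    have h1 := h.norm_sub_le_two_mul hT hp (hS q hq).1 (hS q' hq').1 (hS q hq).2 (hS q' hq').2
    have h2 := (PiLp.antilipschitzWith_ofLp 2 (fun _ : Fin d => ℝ)).le_mul_dist
      (b.repr ((Tan p).orthogonalProjectionOnto q)) (b.repr ((Tan p).orthogonalProjectionOnto q'))
    rw [LinearIsometryEquiv.dist_map, dist_eq_norm, ← map_sub] at h2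
    rw [dist_eq_norm]
    have : (K : ℝ) * dist (f q) (f q') = 2 * (((Fintype.card (Fin d) : ℝ≥0)
        ^ (1 / 2 : ℝ≥0∞).toReal : ℝ≥0) * dist (f q) (f q')) := by
      simp only [K, NNReal.coe_mul, NNReal.coe_ofNat]
      ring
    rw [this]
    exact h1.trans (mul_le_mul_of_nonneg_left h2 two_pos.le)
  have hlip : ∀ q ∈ S, dist (f q) (f p) ≤ ε / 100 := by
    intro q hq
    have h2 := (PiLp.lipschitzWith_ofLp 2 (fun _ : Fin d => ℝ)).dist_le_mul
      (b.repr ((Tan p).orthogonalProjectionOnto q)) (b.repr ((Tan p).orthogonalProjectionOnto p))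
    rw [LinearIsometryEquiv.dist_map, dist_eq_norm ((Tan p).orthogonalProjectionOnto q),
      ← map_sub, NNReal.coe_one, one_mul] at h2
    refine h2.trans (((Tan p).norm_orthogonalProjectionOnto_apply_le _).trans ?_)
    rw [← dist_eq_norm]
    exact (hS q hq).2
  let g := Function.invFunOn f S
  have hgmem : ∀ y ∈ f '' S, g y ∈ S := fun y hy => Function.invFunOn_mem hy
  have hgeq : ∀ y ∈ f '' S, f (g y) = y := fun y hy => Function.invFunOn_eq hy
  have hglip : LipschitzOnWith K g (f '' S) := LipschitzOnWith.of_dist_le_mul fun y hy y' hy' => by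
    have := hanti _ (hgmem y hy) _ (hgmem y' hy')
    rwa [hgeq y hy, hgeq y' hy'] at this
  have hSsub : S ⊆ g '' (f '' S) := fun q hq => by
    refine ⟨f q, mem_image_of_mem f hq, ?_⟩
    have := hanti _ (hgmem (f q) (mem_image_of_mem f hq)) q hq
    rw [hgeq _ (mem_image_of_mem f hq), dist_self, mul_zero] at this
    exact dist_le_zero.1 this
  have hvol : (μH[d] : Measure (Fin d → ℝ)) = volume := by
    simpa using hausdorffMeasure_pi_real (ι := Fin d)
  calc μH[d] S ≤ μH[d] (g '' (f '' S)) := measure_mono hSsub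
    _ ≤ (K : ℝ≥0∞) ^ (d : ℝ) * μH[d] (f '' S) := hglip.hausdorffMeasure_image_le (by positivity)
    _ ≤ (K : ℝ≥0∞) ^ (d : ℝ) * μH[d] (closedBall (f p) (ε / 100)) := by
      gcongr
      rintro _ ⟨q, hq, rfl⟩
      exact hlip q hq
    _ = _ := by rw [hvol, Real.volume_pi_closedBall _ (by positivity), Fintype.card_fin]

theorem exists_hausdorffMeasure_inter_ball_le (h : IsTubularProjection W ε pr)
    (hT : IsTangentField W Tan) {d : ℕ} (hd : ∀ p ∈ W, Module.finrank ℝ (Tan p) = d) (R : ℝ) :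
    ∃ C : ℝ≥0∞, C ≠ ⊤ ∧ ∀ z : E, μH[d] (W ∩ ball z R) ≤ C := by
  obtain ⟨C, hC, hle⟩ := h.exists_hausdorffMeasure_inter_ball_le_of_small hT hd
  have := FiniteDimensional.proper_real E
  have htb : TotallyBounded (ball (0 : E) R) :=
    (isCompact_closedBall (0 : E) R).totallyBounded.subset ball_subset_closedBall
  obtain ⟨t, ht, hcov⟩ := Metric.totallyBounded_iff.1 htb (ε / 200) (by linarith [h.pos])
  lift t to Finset E using ht
  refine ⟨t.card * C, ENNReal.mul_ne_top (ENNReal.natCast_ne_top _) hC, fun z => ?_⟩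
  have hsub : W ∩ ball z R ⊆ ⋃ c ∈ t, W ∩ ball (z + c) (ε / 200) := by
    rintro x ⟨hxW, hx⟩
    have hx0 : x - z ∈ ball (0 : E) R := by rwa [mem_ball_zero_iff, ← mem_ball_iff_norm]
    obtain ⟨c, hc, hxc⟩ := mem_iUnion₂.1 (hcov hx0)
    refine mem_iUnion₂.2 ⟨c, hc, hxW, ?_⟩
    rwa [mem_ball_iff_norm, ← sub_sub, ← mem_ball_iff_norm]
  calc μH[d] (W ∩ ball z R) ≤ ∑ c ∈ t, μH[d] (W ∩ ball (z + c) (ε / 200)) :=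
        (measure_mono hsub).trans (measure_biUnion_finset_le t _)
    _ ≤ ∑ _c ∈ t, C := Finset.sum_le_sum fun c _ => hle _
    _ = t.card * C := by rw [Finset.sum_const, nsmul_eq_mul]

end IsTubularProjection

theorem isTangentField_ker {F : Type*} [NormedAddCommGroup F] [NormedSpace ℝ F]
    [FiniteDimensional ℝ F] [CompleteSpace E] {T : E → F} {T' : E → E →L[ℝ] F} (a : F)
    (hT : ∀ p ∈ T ⁻¹' {a}, HasStrictFDerivAt T (T' p) p)
    (hsurj : ∀ p ∈ T ⁻¹' {a}, (T' p : E →ₗ[ℝ] F).range = ⊤) :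
    IsTangentField (T ⁻¹' {a}) (fun p => (T' p : E →ₗ[ℝ] F).ker) where
  inner_isLittleO p hp ν hν := by
    obtain ⟨r, hr⟩ := LinearMap.exists_rightInverse_of_surjective _ (hsurj p hp)
    have hr' : ∀ y, T' p (r y) = y := fun y => LinearMap.congr_fun hr y
    let L : F →L[ℝ] ℝ := (innerSL ℝ ν).comp (LinearMap.toContinuousLinearMap r)
    have hL : ∀ v, ⟪ν, v⟫ = L (T' p v) := fun v => by
      have hv : v - r (T' p v) ∈ (T' p : E →ₗ[ℝ] F).ker := by
        simp [hr']
      have := Submodule.inner_left_of_mem_orthogonal hv hν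
      rw [inner_sub_right, sub_eq_zero] at this
      exact this
    have h1 : (fun q => T' p (q - p)) =o[𝓝[T ⁻¹' {a}] p] fun q => q - p := by
      have h2 := ((hT p hp).hasFDerivAt.isLittleO.mono
        (nhdsWithin_le_nhds (s := T ⁻¹' {a}))).neg_left
      refine h2.congr' ?_ EventuallyEq.rfl
      filter_upwards [self_mem_nhdsWithin] with q hq
      rw [show T q = a from hq, show T p = a from hp]
      simp
    refine ((L.isBigO_comp (fun q => T' p (q - p)) _).trans_isLittleO h1).congr_left fun q => ?_
    exact (hL _).symm
  infDist_isLittleO p hp u hu := by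
    let φ := (hT p hp).implicitFunction T (T' p) (hsurj p hp) (T p)
    have hφ : HasStrictFDerivAt φ (T' p : E →ₗ[ℝ] F).ker.subtypeL 0 :=
      (hT p hp).to_implicitFunction (hsurj p hp)
    have hφ0 : φ 0 = p := (hT p hp).implicitFunction_apply_image (hsurj p hp)
    let γ : ℝ → (T' p : E →ₗ[ℝ] F).ker := fun s => s • ⟨u, hu⟩
    have hγ : Tendsto γ (𝓝[>] 0) (𝓝 0) := by
      have : Continuous γ := by fun_prop
      simpa [γ] using this.tendsto' 0 0 (by simp [γ]) |>.mono_left nhdsWithin_le_nhds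
    have hmem : ∀ᶠ s in 𝓝[>] (0 : ℝ), φ (γ s) ∈ T ⁻¹' {a} := by
      have h1 : Tendsto (fun s => (T p, γ s)) (𝓝[>] 0) (𝓝 (T p, 0)) :=
        tendsto_const_nhds.prodMk_nhds hγ
      filter_upwards [h1.eventually ((hT p hp).map_implicitFunction_eq (hsurj p hp))] with s hs
      exact hs.trans hp
    have h2 : (fun s => φ (γ s) - (p + s • u)) =o[𝓝[>] 0] fun s : ℝ => s := by
      have h3 := hφ.hasFDerivAt.isLittleO.comp_tendsto hγ
      have h4 : (fun s => γ s) =O[𝓝[>] 0] fun s : ℝ => s :=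
        IsBigO.of_bound ‖u‖ (Eventually.of_forall fun s => by
          simp [γ, norm_smul, mul_comm])
      refine (h3.trans_isBigO (h4.congr_left fun s => by simp)).congr_left fun s => ?_
      simp [hφ0, γ, sub_sub]
    refine IsBigO.trans_isLittleO (IsBigO.of_bound 1 ?_) h2
    filter_upwards [hmem] with s hs
    rw [one_mul, Real.norm_of_nonneg infDist_nonneg, ← dist_eq_norm, dist_comm]
    exact infDist_le_dist_of_mem hs

end TubularProjection

theorem continuous_fderiv_of_differentiable {E F : Type*} [NormedAddCommGroup E] [NormedSpace ℂ E]
    [FiniteDimensional ℂ E] [NormedAddCommGroup F] [NormedSpace ℂ F] [CompleteSpace F]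
    {f : E → F} (hf : Differentiable ℂ f) : Continuous (fderiv ℂ f) := by
  rw [continuous_clm_apply]
  intro v
  have hcauchy : ∀ x, fderiv ℂ f x v = (2 * ↑Real.pi * Complex.I : ℂ)⁻¹ •
      ∮ z in C(0, 1), ((z - 0) ^ 2)⁻¹ • f (x + z • v) := by
    intro x
    have hline : ∀ z : ℂ, HasDerivAt (fun z : ℂ => x + z • v) v z := fun z => by
      simpa using ((hasDerivAt_id z).smul_const v).const_add x
    have hd : ∀ z : ℂ, HasDerivAt (fun z : ℂ => f (x + z • v)) (fderiv ℂ f (x + z • v) v) z :=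
      fun z => (hf _).hasFDerivAt.comp_hasDerivAt z (hline z)
    rw [Complex.two_pi_I_inv_smul_circleIntegral_sub_sq_inv_smul_of_differentiable isOpen_univ
      (subset_univ _) (fun z _ => (hd z).differentiableAt.differentiableWithinAt)
      (mem_ball_self one_pos), (hd 0).deriv]
    simp
  simp_rw [hcauchy, circleIntegral]
  refine Continuous.const_smul ?_ _
  refine intervalIntegral.continuous_parametric_intervalIntegral_of_continuous' ?_ _ _
  have h1 : Continuous fun p : E × ℝ => circleMap 0 1 p.2 := by fun_prop
  have h2 : Continuous fun p : E × ℝ => ((circleMap 0 1 p.2 - 0) ^ 2)⁻¹ :=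
    ((h1.sub continuous_const).pow 2).inv₀ fun p => by simp [circleMap]
  have h3 := hf.continuous
  simp only [Function.uncurry_def, deriv_circleMap]
  exact (h1.mul continuous_const).smul (h2.smul (h3.comp (by fun_prop)))

theorem exists_hausdorffMeasure_zeros_inter_ball_le {n : ℕ} {T : En n → ℂ}
    (hT : Differentiable ℂ T) {W : Set (En n)} (hWT : W = T ⁻¹' {0})
    (hdT : ∀ z ∈ W, fderiv ℂ T z ≠ 0) (hflat : UniformlyFlat W) (R : ℝ) :
    ∃ C : ℝ≥0∞, C ≠ ⊤ ∧ ∀ z : En n, μH[(2 * n - 2 : ℝ)] (W ∩ ball z R) ≤ C := by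
  obtain rfl | ⟨p₀, hp₀⟩ := W.eq_empty_or_nonempty
  · exact ⟨0, ENNReal.zero_ne_top, fun z => by simp⟩
  obtain ⟨ε, hε, pr, hsm, hpr⟩ := hflat
  have hproj : IsTubularProjection W ε pr :=
    ⟨hε, hsm, fun z hz => (hpr z hz).1, fun z hz => (hpr z hz).2.1⟩
  have hT1 : ContDiff ℂ 1 T :=
    contDiff_one_iff_fderiv.2 ⟨hT, continuous_fderiv_of_differentiable hT⟩
  have hstrict : ∀ p, HasStrictFDerivAt T ((fderiv ℂ T p).restrictScalars ℝ) p := fun p =>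
    (hT1.contDiffAt.hasStrictFDerivAt one_ne_zero).restrictScalars ℝ
  have hne : ∀ p ∈ W, (fderiv ℂ T p : En n →ₗ[ℂ] ℂ) ≠ 0 := fun p hp h0 =>
    hdT p hp (ContinuousLinearMap.coe_injective h0)
  have hsurj : ∀ p ∈ W, (((fderiv ℂ T p).restrictScalars ℝ : En n →L[ℝ] ℂ) :
      En n →ₗ[ℝ] ℂ).range = ⊤ := fun p hp =>
    LinearMap.range_eq_top.2 (LinearMap.surjective (hne p hp))
  have htan : IsTangentField W
      (fun p => (((fderiv ℂ T p).restrictScalars ℝ : En n →L[ℝ] ℂ) : En n →ₗ[ℝ] ℂ).ker) := by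
    subst hWT
    exact isTangentField_ker 0 (fun p _ => hstrict p) hsurj
  have hker : ∀ p ∈ W, Module.finrank ℂ (fderiv ℂ T p : En n →ₗ[ℂ] ℂ).ker + 1 = n :=
    fun p hp => by
      rw [Module.Dual.finrank_ker_add_one_of_ne_zero (hne p hp), finrank_euclideanSpace_fin]
  have hdim : ∀ p ∈ W, Module.finrank ℝ
      (((fderiv ℂ T p).restrictScalars ℝ : En n →L[ℝ] ℂ) : En n →ₗ[ℝ] ℂ).ker = 2 * (n - 1) :=
    fun p hp => by
      rw [← Nat.eq_sub_of_add_eq (hker p hp)]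
      exact finrank_real_of_complex (fderiv ℂ T p : En n →ₗ[ℂ] ℂ).ker
  have hn : 1 ≤ n := by
    have := hker p₀ hp₀
    omega
  have := hproj.exists_hausdorffMeasure_inter_ball_le htan hdim R
  rwa [show ((2 * (n - 1) : ℕ) : ℝ) = 2 * n - 2 by push_cast [hn]; ring] at this

/-- **Proposition (uniform area bound).**  If `W = T⁻¹(0)` is a uniformly flat smooth
closed complex hypersurface in `ℂⁿ`, then for each `R > 0` there is `C_R > 0` such that
`σ(W ∩ B(z,R)) ≤ C_R` for all `z ∈ ℂⁿ`. -/
theorem uniformly_flat_area_bound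
    (n : ℕ) (T : En n → ℂ) (hT : Differentiable ℂ T)
    (W : Set (En n)) (hWT : W = T ⁻¹' {0})
    (hdT : ∀ z ∈ W, fderiv ℂ T z ≠ 0)
    (hflat : UniformlyFlat W) :
    ∀ R > (0 : ℝ), ∃ CR > (0 : ℝ), ∀ z : En n,
      surf n W (Metric.ball z R) ≤ ENNReal.ofReal CR := by
  intro R _
  obtain ⟨C, hC, hle⟩ := exists_hausdorffMeasure_zeros_inter_ball_le hT hWT hdT hflat R
  have hM : (2 : ℝ≥0∞) ^ (n - 1) * (Nat.factorial (n - 1) : ℝ≥0∞) * C ≠ ⊤ := by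
    finiteness
  refine ⟨((2 : ℝ≥0∞) ^ (n - 1) * (Nat.factorial (n - 1) : ℝ≥0∞) * C).toReal + 1,
    by positivity, fun z => ?_⟩
  refine le_trans ?_ (ENNReal.ofReal_le_ofReal (le_add_of_nonneg_right zero_le_one))
  rw [ENNReal.ofReal_toReal hM, surf, Measure.smul_apply, smul_eq_mul,
    Measure.restrict_apply measurableSet_ball, inter_comm]
  gcongr
  exact hle z
end
end

section
/- Let n ≥ 2, let W ⊂ ℂⁿ be a uniformly flat smooth closed complex hypersurface, and let r > 0. Then the singularity s_r satisfies: (1) s_r(z) ≤ 0 for all z ∈ ℂⁿ; and (2) for every ε > 0 there is a constant C_{r,ε} > 0 such that s_r(z) ≥ −C_{r,ε} whenever dist(z, W) ≥ ε. -/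
open MeasureTheory Metric Set
open scoped ENNReal NNReal Topology

noncomputable section

/-- The Newton potential `G(z,ζ) = -c(n)|z-ζ|^{2-2n}`, `c(n) = 1/(πⁿ 2ⁿ (n-1))`. -/
def newton (n : ℕ) (z ζ : En n) : ℝ :=
  -(Real.pi ^ n * 2 ^ n * ((n : ℝ) - 1))⁻¹ * ‖z - ζ‖ ^ ((2 : ℝ) - 2 * n)

/-- `Γ_r(z,ζ) = G(z,ζ) - (1/vol B(z,r)) ∫_{B(z,r)} G(ζ,x) dV(x)`. -/
def GammaR (n : ℕ) (r : ℝ) (z ζ : En n) : ℝ :=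
  newton n z ζ -
    ((vol n) (Metric.ball z r)).toReal⁻¹ * ∫ x in Metric.ball z r, newton n ζ x ∂(vol n)

/-- The singularity `s_r(z) = π ∫_{W ∩ B(z,r)} Γ_r(z,ζ) dσ(ζ)`. -/
def singR (n : ℕ) (W : Set (En n)) (r : ℝ) (z : En n) : ℝ :=
  Real.pi * ∫ ζ in Metric.ball z r, GammaR n r z ζ ∂(surf n W)

section SuperMeanValue

open Filter
open scoped RealInnerProductSpace Pointwise

variable {E : Type*} [NormedAddCommGroup E]

/-- The Lipschitz function equal to `(1 - ‖x‖²) / 2` on the unit ball and to `0` outside. -/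
def ballPotential (x : E) : ℝ := (1 - (min ‖x‖ 1) ^ 2) / 2

lemma ballPotential_of_le {x : E} (hx : ‖x‖ ≤ 1) : ballPotential x = (1 - ‖x‖ ^ 2) / 2 := by
  rw [ballPotential, min_eq_left hx]

lemma ballPotential_of_ge {x : E} (hx : 1 ≤ ‖x‖) : ballPotential x = 0 := by
  rw [ballPotential, min_eq_right hx]; norm_num

lemma lipschitzWith_ballPotential : LipschitzWith 1 (ballPotential : E → ℝ) := by
  refine LipschitzWith.of_le_add fun x y => ?_
  have h1 : min ‖y‖ 1 ≤ min ‖x‖ 1 + dist x y := by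
    have : ‖y‖ ≤ ‖x‖ + dist x y := by
      rw [dist_eq_norm]; linarith [norm_le_norm_add_norm_sub' y x, norm_sub_rev x y]
    have hd := dist_nonneg (x := x) (y := y)
    rcases le_total ‖x‖ 1 with h | h
    · rw [min_eq_left h]; exact (min_le_left _ _).trans this
    · rw [min_eq_right h]; exact (min_le_right _ _).trans (by linarith)
  have hx0 : 0 ≤ min ‖x‖ 1 := le_min (norm_nonneg _) zero_le_one
  have hy0 : 0 ≤ min ‖y‖ 1 := le_min (norm_nonneg _) zero_le_one
  have hx1 : min ‖x‖ 1 ≤ 1 := min_le_right _ _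
  have hy1 : min ‖y‖ 1 ≤ 1 := min_le_right _ _
  have hd := dist_nonneg (x := x) (y := y)
  simp only [ballPotential]
  rcases le_total (min ‖y‖ 1) (min ‖x‖ 1) with h | h <;> nlinarith

lemma hasCompactSupport_ballPotential [NormedSpace ℝ E] [FiniteDimensional ℝ E] :
    HasCompactSupport (ballPotential : E → ℝ) := by
  refine HasCompactSupport.intro (isCompact_closedBall (0 : E) 1) fun x hx => ?_
  apply ballPotential_of_ge
  simp only [mem_closedBall, dist_zero_right, not_le] at hx
  exact hx.le

variable [InnerProductSpace ℝ E]

lemma lineDeriv_ballPotential_of_lt {x : E} (hx : ‖x‖ < 1) (v : E) :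
    lineDeriv ℝ ballPotential x (-v) = ⟪x, v⟫ := by
  have h1 : HasFDerivAt (fun y : E => (1 - ‖y‖ ^ 2) / 2) (-(innerSL ℝ x)) x := by
    have := ((hasStrictFDerivAt_norm_sq x).hasFDerivAt.const_sub 1).const_mul (1 / 2 : ℝ)
    refine (this.congr_fderiv ?_).congr_of_eventuallyEq (.of_forall fun y => ?_)
    · ext y; simp
    · ring
  have h2 : (ballPotential : E → ℝ) =ᶠ[𝓝 x] fun y => (1 - ‖y‖ ^ 2) / 2 := by
    filter_upwards [continuous_norm.continuousAt.eventually_lt continuousAt_const hx] with y hy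
    exact ballPotential_of_le hy.le
  have h3 := (h1.congr_of_eventuallyEq h2).hasLineDerivAt (-v)
  rw [h3.lineDeriv]; simp

lemma lineDeriv_ballPotential_of_gt {x : E} (hx : 1 < ‖x‖) (v : E) :
    lineDeriv ℝ ballPotential x v = 0 := by
  have h2 : (ballPotential : E → ℝ) =ᶠ[𝓝 x] fun _ => (0 : ℝ) := by
    filter_upwards [(continuousAt_const (y := (1 : ℝ))).eventually_lt
      continuous_norm.continuousAt hx] with y hy
    exact ballPotential_of_ge hy.le
  have h3 := ((hasFDerivAt_const (𝕜 := ℝ) (0 : ℝ) x).congr_of_eventuallyEq h2).hasLineDerivAt v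
  rw [h3.lineDeriv]; simp

/-- The smooth regularization `(‖x‖² + ε)^{-k}` of the Newton kernel. -/
def regKernel (k : ℕ) (ε : ℝ) (x : E) : ℝ := ((‖x‖ ^ 2 + ε) ^ k)⁻¹

lemma hasFDerivAt_regKernel (k : ℕ) {ε : ℝ} (hε : 0 < ε) (x : E) :
    HasFDerivAt (regKernel k ε) ((-(2 * k) * regKernel (k + 1) ε x) • innerSL ℝ x) x := by
  have hp : 0 < ‖x‖ ^ 2 + ε := by positivity
  have h1 : HasFDerivAt (fun y : E => ‖y‖ ^ 2 + ε) (2 • innerSL ℝ x) x :=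
    (hasStrictFDerivAt_norm_sq x).hasFDerivAt.add_const ε
  have h2 : HasDerivAt (fun t : ℝ => (t ^ k)⁻¹)
      (-(k * (‖x‖ ^ 2 + ε) ^ (k - 1)) / ((‖x‖ ^ 2 + ε) ^ k) ^ 2) (‖x‖ ^ 2 + ε) :=
    (hasDerivAt_pow k _).inv (by positivity)
  have h3 := h2.comp_hasFDerivAt x h1
  refine h3.congr_fderiv ?_
  ext y
  simp only [regKernel, smul_apply, smul_eq_mul, nsmul_eq_mul,
    Nat.cast_ofNat, innerSL_apply_apply]
  rcases k with _ | k
  · simp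
  · simp only [Nat.add_sub_cancel]
    field_simp
    ring

lemma contDiff_regKernel (k : ℕ) {ε : ℝ} (hε : 0 < ε) :
    ContDiff ℝ 2 (regKernel k ε : E → ℝ) := by
  unfold regKernel
  refine ContDiff.inv (((contDiff_norm_sq ℝ).add contDiff_const).pow k) fun x => ?_
  positivity

variable [FiniteDimensional ℝ E] [MeasurableSpace E] [BorelSpace E]
  (μ : Measure E) [μ.IsAddHaarMeasure]

/-- Integration by parts on the unit ball against the potential `(1 - ‖x‖²) / 2`. -/
lemma setIntegral_ball_inner_mul {g : E → ℝ} (hg : ContDiff ℝ 1 g) (v : E) :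
    ∫ x in ball (0 : E) 1, ⟪x, v⟫ * g x ∂μ
      = ∫ x in ball (0 : E) 1, (1 - ‖x‖ ^ 2) / 2 * fderiv ℝ g x v ∂μ := by
  obtain ⟨K, hK⟩ : ∃ K, LipschitzOnWith K g (closedBall (0 : E) 1) :=
    hg.locallyLipschitz.locallyLipschitzOn.exists_lipschitzOnWith_of_compact
      (isCompact_closedBall (0 : E) 1)
  obtain ⟨F, hF, hFg⟩ := hK.extend_real
  have key := LipschitzWith.integral_lineDeriv_mul_eq (μ := μ) hF lipschitzWith_ballPotential
    hasCompactSupport_ballPotential v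
  have h1 : ∀ x, lineDeriv ℝ F x v * ballPotential x
      = (ball (0 : E) 1).indicator (fun x => (1 - ‖x‖ ^ 2) / 2 * fderiv ℝ g x v) x := by
    intro x
    by_cases hx : ‖x‖ < 1
    · rw [indicator_of_mem (by simpa using hx), ballPotential_of_le hx.le, mul_comm]
      congr 1
      have h2 : F =ᶠ[𝓝 x] g := by
        filter_upwards [isOpen_ball.mem_nhds (show x ∈ ball (0 : E) 1 by simpa using hx)] with y hy
        exact (hFg (ball_subset_closedBall hy)).symm
      exact (((hg.differentiable one_ne_zero x).hasFDerivAt.congr_of_eventuallyEq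
        h2).hasLineDerivAt v).lineDeriv
    · rw [indicator_of_notMem (by simpa using hx), ballPotential_of_ge (not_lt.1 hx), mul_zero]
  have h2 : ∀ᵐ x ∂μ, lineDeriv ℝ ballPotential x (-v) * F x
      = (ball (0 : E) 1).indicator (fun x => ⟪x, v⟫ * g x) x := by
    have h0 : ∀ᵐ x ∂μ, x ∉ sphere (0 : E) 1 :=
      measure_eq_zero_iff_ae_notMem.1 (Measure.addHaar_sphere_of_ne_zero μ 0 one_ne_zero)
    filter_upwards [h0] with x hx
    have hx' : ‖x‖ ≠ 1 := by simpa using hx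
    rcases lt_or_gt_of_ne hx' with h | h
    · rw [indicator_of_mem (by simpa using h), lineDeriv_ballPotential_of_lt h,
        hFg (show x ∈ closedBall (0 : E) 1 by simpa using h.le)]
    · rw [indicator_of_notMem (by simpa using h.le), lineDeriv_ballPotential_of_gt h, zero_mul]
  rw [integral_congr_ae h2, integral_congr_ae (Eventually.of_forall h1),
    integral_indicator measurableSet_ball, integral_indicator measurableSet_ball] at key
  exact key.symm

lemma Continuous.integrableOn_unitBall {f : E → ℝ} (hf : Continuous f) :
    IntegrableOn f (ball (0 : E) 1) μ :=
  (hf.continuousOn.integrableOn_compact (isCompact_closedBall (0 : E) 1)).mono_set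
    ball_subset_closedBall

/-- The derivative in `s` of the integral of the regularized kernel over `B(a, s)`, rescaled to
the unit ball. -/
lemma hasDerivAt_setIntegral_regKernel (k : ℕ) {ε : ℝ} (hε : 0 < ε) (a : E) (s : ℝ) :
    HasDerivAt (fun s : ℝ => ∫ x in ball (0 : E) 1, regKernel k ε (a + s • x) ∂μ)
      (∫ x in ball (0 : E) 1,
        -(2 * k) * regKernel (k + 1) ε (a + s • x) * ⟪a + s • x, x⟫ ∂μ) s := by
  have hc : ∀ j, Continuous (regKernel j ε : E → ℝ) := fun j => (contDiff_regKernel j hε).continuous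
  have hcF : Continuous fun p : ℝ × E =>
      -(2 * k) * regKernel (k + 1) ε (a + p.1 • p.2) * ⟪a + p.1 • p.2, p.2⟫ := by
    have := hc (k + 1)
    fun_prop
  obtain ⟨C, hC⟩ := ((isCompact_closedBall s 1).prod
    (isCompact_closedBall (0 : E) 1)).exists_bound_of_continuousOn hcF.continuousOn
  refine (hasDerivAt_integral_of_dominated_loc_of_deriv_le (𝕜 := ℝ)
    (μ := μ.restrict (ball (0 : E) 1)) (F := fun t x => regKernel k ε (a + t • x))
    (F' := fun t x => -(2 * k) * regKernel (k + 1) ε (a + t • x) * ⟪a + t • x, x⟫)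
    (bound := fun _ => C) (ball_mem_nhds s one_pos) (.of_forall fun t => ?_) ?_ ?_ ?_ ?_ ?_).2
  · have := hc k
    exact Continuous.aestronglyMeasurable (by fun_prop)
  · have := hc k
    exact Continuous.integrableOn_unitBall μ (by fun_prop)
  · exact (hcF.comp (by fun_prop : Continuous fun x : E => (s, x))).aestronglyMeasurable
  · filter_upwards [ae_restrict_mem measurableSet_ball] with x hx t ht
    exact hC (t, x) ⟨ball_subset_closedBall ht, ball_subset_closedBall hx⟩
  · exact integrableOn_const measure_ball_lt_top.ne
  · refine .of_forall fun x t _ => ?_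
    have h1 : HasDerivAt (fun t : ℝ => a + t • x) x t := by
      simpa using ((hasDerivAt_id t).smul_const x).const_add a
    have h2 := (hasFDerivAt_regKernel k hε (a + t • x)).comp_hasDerivAt t h1
    exact h2

lemma setIntegral_deriv_regKernel_nonpos (k : ℕ) (hk : Module.finrank ℝ E = 2 * k + 2) {ε : ℝ}
    (hε : 0 < ε) (a : E) {s : ℝ} (hs : 0 ≤ s) :
    ∫ x in ball (0 : E) 1,
      -(2 * k) * regKernel (k + 1) ε (a + s • x) * ⟪a + s • x, x⟫ ∂μ ≤ 0 := by
  let b := stdOrthonormalBasis ℝ E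
  let g : Fin (Module.finrank ℝ E) → E → ℝ := fun i x =>
    -(2 * k) * (regKernel (k + 1) ε (a + s • x) * ⟪b i, a + s • x⟫)
  have hg : ∀ i, ContDiff ℝ 2 (g i) := by
    intro i
    have h1 : ContDiff ℝ 2 fun x : E => a + s • x := by fun_prop
    have h2 := (contDiff_regKernel (k + 1) hε).comp h1
    have h3 : ContDiff ℝ 2 fun x : E => ⟪b i, a + s • x⟫ := contDiff_const.inner ℝ h1
    exact contDiff_const.mul (h2.mul h3)
  have hsum : ∀ x : E, -(2 * k) * regKernel (k + 1) ε (a + s • x) * ⟪a + s • x, x⟫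
      = ∑ i, ⟪x, b i⟫ * g i x := by
    intro x
    rw [real_inner_comm, ← b.sum_inner_mul_inner x (a + s • x), Finset.mul_sum]
    refine Finset.sum_congr rfl fun i _ => ?_
    simp only [g]; ring
  have hder : ∀ x : E, ∑ i, fderiv ℝ (g i) x (b i)
      = -(2 * k) * (s * (2 * k + 2) * ε * regKernel (k + 2) ε (a + s • x)) := by
    intro x
    have h1 : HasFDerivAt (fun x : E => a + s • x) (s • ContinuousLinearMap.id ℝ E) x :=
      ((hasFDerivAt_id x).const_smul s).const_add a
    have h2 := (hasFDerivAt_regKernel (k + 1) hε (a + s • x)).comp x h1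
    have h3 : ∀ i, fderiv ℝ (g i) x (b i) = -(2 * k) * (s * regKernel (k + 1) ε (a + s • x)
        - 2 * (k + 1) * s * regKernel (k + 2) ε (a + s • x) * ⟪b i, a + s • x⟫ ^ 2) := by
      intro i
      have h4 : HasFDerivAt (fun x : E => ⟪b i, a + s • x⟫)
          ((innerSL ℝ (b i)).comp (s • ContinuousLinearMap.id ℝ E)) x :=
        (innerSL ℝ (b i)).hasFDerivAt.comp x h1
      have h5 : HasFDerivAt (g i) _ x := (h2.mul h4).const_mul (-(2 * (k : ℝ)))
      rw [h5.fderiv]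
      simp only [Function.comp_apply, smul_apply, add_apply, ContinuousLinearMap.comp_apply,
        innerSL_apply_apply, ContinuousLinearMap.id_apply, inner_smul_right, smul_eq_mul,
        real_inner_self_eq_norm_sq, b.norm_eq_one, real_inner_comm (b i) (a + s • x)]
      push_cast
      ring
    have h6 : ‖a + s • x‖ ^ 2 = ∑ i, ⟪b i, a + s • x⟫ ^ 2 := by
      rw [← b.sum_sq_norm_inner_right (a + s • x)]
      simp
    have h7 : regKernel (k + 1) ε (a + s • x)
        = (‖a + s • x‖ ^ 2 + ε) * regKernel (k + 2) ε (a + s • x) := by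
      have : 0 < ‖a + s • x‖ ^ 2 + ε := by positivity
      simp only [regKernel]
      field_simp
      ring
    simp only [h3]
    rw [← Finset.mul_sum, Finset.sum_sub_distrib, ← Finset.mul_sum (a := 2 * ((k : ℝ) + 1) * s *
      regKernel (k + 2) ε (a + s • x)), ← h6, h7]
    simp only [Finset.sum_const, Finset.card_univ, Fintype.card_fin, nsmul_eq_mul, hk]
    push_cast
    ring
  have hck : Continuous (regKernel (k + 2) ε : E → ℝ) := (contDiff_regKernel _ hε).continuous
  simp only [hsum]
  rw [integral_finsetSum]
  · simp only [setIntegral_ball_inner_mul μ ((hg _).of_le one_le_two)]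
    rw [← integral_finsetSum]
    · refine setIntegral_nonpos measurableSet_ball fun x hx => ?_
      rw [← Finset.mul_sum, hder]
      have h1 : ‖x‖ ^ 2 ≤ 1 := by
        have : ‖x‖ < 1 := by simpa using hx
        nlinarith [norm_nonneg x]
      have h2 : 0 ≤ regKernel (k + 2) ε (a + s • x) := by unfold regKernel; positivity
      have h3 : 0 ≤ (1 - ‖x‖ ^ 2) / 2 := by linarith
      have h4 : 0 ≤ 2 * k * (s * (2 * k + 2) * ε * regKernel (k + 2) ε (a + s • x)) := by
        positivity
      nlinarith
    · intro i _
      have h1 : Continuous fun x => fderiv ℝ (g i) x (b i) :=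
        ((hg i).continuous_fderiv two_ne_zero).clm_apply continuous_const
      exact Continuous.integrableOn_unitBall μ (by fun_prop)
  · intro i _
    have h1 := (hg i).continuous
    exact Continuous.integrableOn_unitBall μ (by fun_prop)

/-- Averages of the regularized kernel over balls are at most its value at the centre. -/
lemma setIntegral_regKernel_le (k : ℕ) (hk : Module.finrank ℝ E = 2 * k + 2) {ε : ℝ}
    (hε : 0 < ε) (a : E) {r : ℝ} (hr : 0 ≤ r) :
    ∫ x in ball (0 : E) 1, regKernel k ε (a + r • x) ∂μ
      ≤ μ.real (ball 0 1) * regKernel k ε a := by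
  have hd := hasDerivAt_setIntegral_regKernel μ k hε a
  have hanti : AntitoneOn (fun s : ℝ => ∫ x in ball (0 : E) 1, regKernel k ε (a + s • x) ∂μ)
      (Ici 0) := by
    refine antitoneOn_of_deriv_nonpos (convex_Ici 0)
      (fun s _ => (hd s).continuousAt.continuousWithinAt)
      (fun s _ => (hd s).differentiableAt.differentiableWithinAt) fun s hs => ?_
    rw [(hd s).deriv]
    exact setIntegral_deriv_regKernel_nonpos μ k hk hε a (by simpa using interior_subset hs)
  simpa using hanti self_mem_Ici hr hr

/-- The super mean value property of the Newton kernel `‖x‖^{-2k}` in real dimension `2k + 2`,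
for the average over the unit ball rescaled to radius `r`. -/
lemma setLIntegral_kernel_unitBall_le (k : ℕ) (hk : Module.finrank ℝ E = 2 * k + 2) {a : E}
    (ha : a ≠ 0) {r : ℝ} (hr : 0 < r) :
    ∫⁻ x in ball (0 : E) 1, ENNReal.ofReal ((‖a + r • x‖ ^ (2 * k))⁻¹) ∂μ
      ≤ μ (ball 0 1) * ENNReal.ofReal ((‖a‖ ^ (2 * k))⁻¹) := by
  have hpos : ∀ m : ℕ, (0 : ℝ) < 1 / ((m : ℝ) + 1) := fun m => by positivity
  have hlim : ∀ y : E, y ≠ 0 → Tendsto (fun m : ℕ => regKernel k (1 / ((m : ℝ) + 1)) y) atTop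
      (𝓝 ((‖y‖ ^ (2 * k))⁻¹)) := by
    intro y hy
    have h1 : Tendsto (fun m : ℕ => ‖y‖ ^ 2 + 1 / ((m : ℝ) + 1)) atTop (𝓝 (‖y‖ ^ 2)) := by
      simpa using tendsto_const_nhds.add (tendsto_one_div_add_atTop_nhds_zero_nat (𝕜 := ℝ))
    have h2 := (h1.pow k).inv₀ (by positivity)
    rwa [← pow_mul] at h2
  have hnonneg : ∀ (ε : ℝ), 0 < ε → ∀ y : E, 0 ≤ regKernel k ε y := fun ε h y => by
    unfold regKernel; positivity
  have hne : ∀ᵐ x ∂(μ.restrict (ball (0 : E) 1)), a + r • x ≠ 0 := by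
    refine ae_restrict_of_ae ?_
    have : Nontrivial E := ⟨a, 0, ha⟩
    have h0 : ∀ᵐ x ∂μ, x ∉ ({-(r⁻¹ • a)} : Set E) :=
      measure_eq_zero_iff_ae_notMem.1 (measure_singleton _)
    filter_upwards [h0] with x hx h
    apply hx
    have : r • x = -a := by rw [eq_neg_iff_add_eq_zero, add_comm]; exact h
    rw [mem_singleton_iff, ← smul_neg, ← this, inv_smul_smul₀ hr.ne']
  have hcont : ∀ m : ℕ, Continuous fun x : E => regKernel k (1 / ((m : ℝ) + 1)) (a + r • x) :=
    fun m => by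
      have := (contDiff_regKernel (E := E) k (hpos m)).continuous
      fun_prop
  have h1 := lintegral_tendsto_of_tendsto_of_monotone (μ := μ.restrict (ball (0 : E) 1))
    (f := fun (m : ℕ) x => ENNReal.ofReal (regKernel k (1 / ((m : ℝ) + 1)) (a + r • x)))
    (F := fun x => ENNReal.ofReal ((‖a + r • x‖ ^ (2 * k))⁻¹))
    (fun m => (hcont m).measurable.ennreal_ofReal.aemeasurable)
    (.of_forall fun x m m' hm => by
      refine ENNReal.ofReal_le_ofReal ?_
      have := hpos m'
      unfold regKernel
      gcongr)
    (by
      filter_upwards [hne] with x hx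
      exact (ENNReal.continuous_ofReal.tendsto _).comp (hlim _ hx))
  have h2 : Tendsto (fun m : ℕ => μ (ball (0 : E) 1)
      * ENNReal.ofReal (regKernel k (1 / ((m : ℝ) + 1)) a)) atTop
      (𝓝 (μ (ball 0 1) * ENNReal.ofReal ((‖a‖ ^ (2 * k))⁻¹))) :=
    ENNReal.Tendsto.const_mul ((ENNReal.continuous_ofReal.tendsto _).comp (hlim a ha))
      (.inr measure_ball_lt_top.ne)
  refine le_of_tendsto_of_tendsto' h1 h2 fun m => ?_
  rw [← ofReal_integral_eq_lintegral_ofReal ((hcont m).integrableOn_unitBall μ)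
    (.of_forall fun x => hnonneg _ (hpos m) _)]
  refine (ENNReal.ofReal_le_ofReal (setIntegral_regKernel_le μ k hk (hpos m) a hr.le)).trans ?_
  rw [ENNReal.ofReal_mul measureReal_nonneg, ofReal_measureReal]

/-- The super mean value property of the Newton kernel `‖x‖^{-2k}` in real dimension
`2k + 2`. -/
lemma average_kernel_ball_le (k : ℕ) (hk : Module.finrank ℝ E = 2 * k + 2) {z w : E}
    (hzw : z ≠ w) {r : ℝ} (hr : 0 < r) :
    (μ.real (ball z r))⁻¹ * ∫ x in ball z r, (‖w - x‖ ^ (2 * k))⁻¹ ∂μ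
      ≤ (‖z - w‖ ^ (2 * k))⁻¹ := by
  have h1 : ∫ x in ball (0 : E) 1, (‖(z - w) + r • x‖ ^ (2 * k))⁻¹ ∂μ
      ≤ μ.real (ball 0 1) * (‖z - w‖ ^ (2 * k))⁻¹ := by
    have h2 := setLIntegral_kernel_unitBall_le μ k hk (sub_ne_zero.2 hzw) hr
    rw [integral_eq_lintegral_of_nonneg_ae (.of_forall fun x => by positivity)]
    · refine (ENNReal.toReal_mono ?_ h2).trans_eq ?_
      · exact ENNReal.mul_ne_top measure_ball_lt_top.ne ENNReal.ofReal_ne_top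
      · rw [ENNReal.toReal_mul, ENNReal.toReal_ofReal (by positivity)]; rfl
    · exact Measurable.aestronglyMeasurable (by fun_prop)
  have h3 := Measure.setIntegral_comp_smul_of_pos μ
    (fun y => (‖(z - w) + y‖ ^ (2 * k))⁻¹) (ball (0 : E) 1) hr
  have h4 : r • ball (0 : E) 1 = ball 0 r := by
    rw [_root_.smul_ball hr.ne', smul_zero, Real.norm_of_nonneg hr.le, mul_one]
  have h5 : ∫ x in ball z r, (‖w - x‖ ^ (2 * k))⁻¹ ∂μ
      = ∫ y in ball (0 : E) r, (‖(z - w) + y‖ ^ (2 * k))⁻¹ ∂μ := by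
    have hmp := measurePreserving_add_left μ z
    have hpre : (fun y => z + y) ⁻¹' ball z r = ball (0 : E) r := by
      ext y; simp [mem_ball, dist_eq_norm]
    rw [← hpre, ← hmp.setIntegral_preimage_emb (measurableEmbedding_addLeft z)]
    refine setIntegral_congr_fun (hpre ▸ measurableSet_ball) fun y _ => ?_
    rw [← norm_neg]
    congr 3
    abel
  have hvol : μ.real (ball z r) = r ^ Module.finrank ℝ E * μ.real (ball 0 1) := by
    simp only [measureReal_def, Measure.addHaar_ball_of_pos μ z hr, ENNReal.toReal_mul]
    rw [ENNReal.toReal_ofReal (by positivity)]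
  have hB : 0 < μ.real (ball (0 : E) 1) :=
    ENNReal.toReal_pos (measure_ball_pos μ 0 one_pos).ne' measure_ball_lt_top.ne
  rw [h5, ← h4, hvol, mul_inv, mul_comm (r ^ _)⁻¹, mul_assoc, ← smul_eq_mul (r ^ _)⁻¹, ← h3,
    inv_mul_le_iff₀ hB]
  exact h1

end SuperMeanValue
section Reach

open Filter
open scoped RealInnerProductSpace

variable {E : Type*} [NormedAddCommGroup E] [InnerProductSpace ℝ E]
  {W : Set E} {ε₀ : ℝ} {pr : E → E}

/-- Away from `W`, the distance to `W` grows at unit speed in the direction pointing away from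
the nearest point. -/
lemma eventually_infDist_add_smul_ge (hc : ContinuousOn pr {z | infDist z W < ε₀})
    (hW : ∀ z, infDist z W < ε₀ → pr z ∈ W ∧ dist z (pr z) = infDist z W)
    {y : E} (hy : infDist y W < ε₀) (hy0 : 0 < infDist y W) {η : ℝ} (hη0 : 0 < η) (hη1 : η < 1) :
    ∀ᶠ h in 𝓝[>] (0 : ℝ), infDist y W + (1 - η) * h
      ≤ infDist (y + h • ((infDist y W)⁻¹ • (y - pr y))) W := by
  set d := infDist y W with hd
  set V := d⁻¹ • (y - pr y) with hV
  have hyp : ‖y - pr y‖ = d := by rw [← dist_eq_norm]; exact (hW y hy).2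
  have hV1 : ‖V‖ = 1 := by
    rw [hV, norm_smul, hyp, Real.norm_of_nonneg (by positivity), inv_mul_cancel₀ hy0.ne']
  have hVd : ⟪V, y - pr y⟫ = d := by
    rw [hV, real_inner_smul_left, real_inner_self_eq_norm_sq, hyp]; field_simp
  have hU : IsOpen {z | infDist z W < ε₀} :=
    isOpen_lt (continuous_infDist_pt W) continuous_const
  have hline : Tendsto (fun h : ℝ => y + h • V) (𝓝[>] 0) (𝓝 y) := by
    have : Continuous fun h : ℝ => y + h • V := by fun_prop
    simpa using (this.tendsto 0).mono_left nhdsWithin_le_nhds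
  have hpr : Tendsto (fun h : ℝ => pr (y + h • V)) (𝓝[>] 0) (𝓝 (pr y)) :=
    (hc.continuousAt (hU.mem_nhds hy)).tendsto.comp hline
  have hin : Tendsto (fun h : ℝ => ⟪V, y - pr (y + h • V)⟫) (𝓝[>] 0) (𝓝 d) := by
    rw [← hVd]
    exact tendsto_const_nhds.inner (tendsto_const_nhds.sub hpr)
  have hlt : (1 - η) * d < d := by nlinarith
  filter_upwards [hin.eventually (lt_mem_nhds hlt), hline (hU.mem_nhds hy),
    self_mem_nhdsWithin] with h h1 h2 h3
  have h3' : 0 < h := h3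
  obtain ⟨h4, h5⟩ := hW _ h2
  rw [← h5, dist_eq_norm]
  have h6 : d ≤ ‖y - pr (y + h • V)‖ := by
    rw [← dist_eq_norm]; exact infDist_le_dist_of_mem h4
  have h7 : ‖y + h • V - pr (y + h • V)‖ ^ 2
      = ‖y - pr (y + h • V)‖ ^ 2 + 2 * h * ⟪V, y - pr (y + h • V)⟫ + h ^ 2 := by
    rw [show y + h • V - pr (y + h • V) = (y - pr (y + h • V)) + h • V by abel,
      norm_add_sq_real, real_inner_smul_right, norm_smul, hV1, real_inner_comm,
      Real.norm_of_nonneg h3'.le]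
    ring
  refine le_of_sq_le_sq ?_ (norm_nonneg _)
  rw [h7]
  have h8 : d ^ 2 ≤ ‖y - pr (y + h • V)‖ ^ 2 := by gcongr
  have h9 : 2 * h * ((1 - η) * d) ≤ 2 * h * ⟪V, y - pr (y + h • V)⟫ := by gcongr
  have h10 : (1 - η) ^ 2 ≤ 1 := by nlinarith
  nlinarith [mul_le_mul_of_nonneg_right h10 (sq_nonneg h)]

/-- Near a point off `W`, the distance to `W` increases by `τ` within the ball of radius `τ`. -/
lemma exists_infDist_ge_add [ProperSpace E] (hc : ContinuousOn pr {z | infDist z W < ε₀})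
    (hW : ∀ z, infDist z W < ε₀ → pr z ∈ W ∧ dist z (pr z) = infDist z W)
    {x : E} (hx0 : 0 < infDist x W) {τ : ℝ} (hτ : 0 < τ) (hxτ : infDist x W + τ < ε₀) :
    ∃ y, dist y x ≤ τ ∧ infDist x W + τ ≤ infDist y W := by
  have hK : IsCompact (closedBall x τ) := isCompact_closedBall x τ
  obtain ⟨y, hyK, hy⟩ := hK.exists_isMaxOn ⟨x, mem_closedBall_self hτ.le⟩
    (continuous_infDist_pt W).continuousOn
  refine ⟨y, hyK, ?_⟩
  suffices h : ∀ η : ℝ, 0 < η → η < 1 → infDist x W + (1 - η) * τ ≤ infDist y W by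
    have h1 : Tendsto (fun η : ℝ => infDist x W + (1 - η) * τ) (𝓝[>] 0)
        (𝓝 (infDist x W + τ)) := by
      have : Continuous fun η : ℝ => infDist x W + (1 - η) * τ := by fun_prop
      simpa using (this.tendsto 0).mono_left nhdsWithin_le_nhds
    refine le_of_tendsto h1 ?_
    filter_upwards [Ioo_mem_nhdsGT (zero_lt_one' ℝ)] with η hη
    exact h η hη.1 hη.2
  intro η hη0 hη1
  obtain ⟨u, huK, hu⟩ := hK.exists_isMaxOn ⟨x, mem_closedBall_self hτ.le⟩
    (f := fun y => infDist y W - (1 - η) * dist y x)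
    ((continuous_infDist_pt W).sub (by fun_prop)).continuousOn
  have hux : infDist x W ≤ infDist u W - (1 - η) * dist u x := by
    simpa using hu (mem_closedBall_self hτ.le)
  have huy : infDist u W ≤ infDist y W := hy huK
  rcases (show dist u x ≤ τ from huK).lt_or_eq with hlt | heq
  · exfalso
    have hu0 : 0 < infDist u W := by
      nlinarith [dist_nonneg (x := u) (y := x)]
    have huε : infDist u W < ε₀ := by
      have := infDist_le_infDist_add_dist (s := W) (x := u) (y := x)
      linarith
    set V := (infDist u W)⁻¹ • (u - pr u) with hV
    have hV1 : ‖V‖ = 1 := by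
      rw [hV, norm_smul, ← dist_eq_norm, (hW u huε).2, Real.norm_of_nonneg (by positivity),
        inv_mul_cancel₀ hu0.ne']
    have h1 := eventually_infDist_add_smul_ge hc hW huε hu0 (half_pos hη0) (by linarith : η / 2 < 1)
    have h2 : ∀ᶠ h in 𝓝[>] (0 : ℝ), h < τ - dist u x :=
      nhdsWithin_le_nhds (gt_mem_nhds (by linarith))
    obtain ⟨h, h3, h4, h5⟩ := (h1.and (h2.and self_mem_nhdsWithin)).exists
    have h5' : 0 < h := h5
    rw [← hV] at h3
    have h6 : dist (u + h • V) x ≤ dist u x + h := by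
      calc dist (u + h • V) x ≤ dist (u + h • V) u + dist u x := dist_triangle _ _ _
        _ = dist u x + h := by
          rw [dist_eq_norm, add_sub_cancel_left, norm_smul, hV1, Real.norm_of_nonneg h5'.le]; ring
    have h7 : infDist (u + h • V) W - (1 - η) * dist (u + h • V) x
        ≤ infDist u W - (1 - η) * dist u x :=
      hu (show dist (u + h • V) x ≤ τ by linarith)
    have h8 : (1 - η) * dist (u + h • V) x ≤ (1 - η) * (dist u x + h) := by
      have : 0 ≤ 1 - η := by linarith
      gcongr
    nlinarith
  · rw [heq] at hux; linarith

/-- Federer's inequality for sets of positive reach. -/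
lemma reach_inner_le [ProperSpace E] (hc : ContinuousOn pr {z | infDist z W < ε₀})
    (hW : ∀ z, infDist z W < ε₀ → pr z ∈ W ∧ dist z (pr z) = infDist z W)
    {x : E} (hx : infDist x W < ε₀ / 2) {w : E} (hw : w ∈ W) :
    ε₀ * ⟪w - pr x, x - pr x⟫ ≤ ‖w - pr x‖ ^ 2 * infDist x W := by
  have hd0 : 0 ≤ infDist x W := infDist_nonneg
  have hε : infDist x W < ε₀ := by linarith
  obtain ⟨-, hxp⟩ := hW x hε
  rw [dist_eq_norm] at hxp
  rcases hd0.eq_or_lt with h0 | h0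
  · rw [← h0, norm_eq_zero] at hxp
    rw [← h0, hxp]; simp
  set d := infDist x W with hd
  obtain ⟨y, hy1, hy2⟩ := exists_infDist_ge_add hc hW h0 (τ := ε₀ / 2 - d) (by linarith)
    (by linarith)
  have hτ : d + (ε₀ / 2 - d) = ε₀ / 2 := by ring
  rw [← hd, hτ] at hy2
  set τ := ε₀ / 2 - d with hτd
  have hτ0 : 0 < τ := by rw [hτd]; linarith
  set p := pr x with hp
  have hpW : p ∈ W := (hW x hε).1
  have hyp : ε₀ / 2 ≤ ‖y - p‖ := by
    rw [← dist_eq_norm]; exact hy2.trans (infDist_le_dist_of_mem hpW)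
  have hyw : ε₀ / 2 ≤ ‖w - y‖ := by
    rw [← dist_eq_norm, dist_comm]; exact hy2.trans (infDist_le_dist_of_mem hw)
  rw [dist_eq_norm] at hy1
  have e1 : ‖y - p‖ ^ 2 = ‖y - x‖ ^ 2 + 2 * ⟪y - x, x - p⟫ + d ^ 2 := by
    rw [← sub_add_sub_cancel y x p, norm_add_sq_real, hxp]
  have e2 : (ε₀ / 2) ^ 2 ≤ ‖y - p‖ ^ 2 := by gcongr; linarith
  have e3 : ‖y - x‖ ^ 2 ≤ τ ^ 2 := by gcongr
  have e4 : d * τ ≤ ⟪y - x, x - p⟫ := by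
    have : ε₀ / 2 = d + τ := by rw [hτd]; ring
    rw [this] at e2
    nlinarith
  have e5 : ‖d • (y - x) - τ • (x - p)‖ ^ 2 ≤ 0 := by
    rw [norm_sub_sq_real, norm_smul, norm_smul, real_inner_smul_left, real_inner_smul_right, hxp,
      Real.norm_of_nonneg h0.le, Real.norm_of_nonneg hτ0.le]
    have h1 : d * (τ * (d * τ)) ≤ d * (τ * ⟪y - x, x - p⟫) := by gcongr
    have h2 : d ^ 2 * ‖y - x‖ ^ 2 ≤ d ^ 2 * τ ^ 2 := by gcongr
    nlinarith
  have e6 : d • (y - x) = τ • (x - p) := by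
    rw [← sub_eq_zero, ← norm_eq_zero]
    exact pow_eq_zero_iff two_ne_zero |>.1 (le_antisymm e5 (by positivity))
  have e7 : d • (y - p) = (ε₀ / 2) • (x - p) := by
    rw [← sub_add_sub_cancel y x p, smul_add, e6, ← add_smul, hτd]; congr 1; ring
  have e8 : d * ‖y - p‖ = ε₀ / 2 * d := by
    have := congrArg norm e7
    rwa [norm_smul, norm_smul, hxp, Real.norm_of_nonneg h0.le,
      Real.norm_of_nonneg (by linarith : 0 ≤ ε₀ / 2)] at this
  have e9 : ‖y - p‖ = ε₀ / 2 := by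
    have := mul_left_cancel₀ h0.ne' (e8.trans (mul_comm _ _)); exact this
  have e10 : ‖w - y‖ ^ 2 = ‖w - p‖ ^ 2 - 2 * ⟪w - p, y - p⟫ + ‖y - p‖ ^ 2 := by
    rw [← sub_sub_sub_cancel_right w y p, norm_sub_sq_real]
  have e11 : (ε₀ / 2) ^ 2 ≤ ‖w - y‖ ^ 2 := by gcongr; linarith
  have e12 : 2 * ⟪w - p, y - p⟫ ≤ ‖w - p‖ ^ 2 := by rw [e9] at e10; linarith
  have e13 : d * ⟪w - p, y - p⟫ = ε₀ / 2 * ⟪w - p, x - p⟫ := by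
    rw [← real_inner_smul_right, e7, real_inner_smul_right]
  nlinarith [mul_le_mul_of_nonneg_left e12 h0.le]

/-- Federer's inequality in a direction normal to `W` at `w₀`. -/
lemma reach_inner_normal_le [ProperSpace E] (hε₀ : 0 < ε₀)
    (hc : ContinuousOn pr {z | infDist z W < ε₀})
    (hW : ∀ z, infDist z W < ε₀ → pr z ∈ W ∧ dist z (pr z) = infDist z W)
    {w₀ : E} (hw₀ : w₀ ∈ W) {ν : E}
    (hν : (fun w => ⟪w - w₀, ν⟫) =o[𝓝[W] w₀] fun w => w - w₀) {w : E} (hw : w ∈ W) :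
    ε₀ * ⟪w - w₀, ν⟫ ≤ ‖w - w₀‖ ^ 2 * ‖ν‖ := by
  let x : ℝ → E := fun t => w₀ + t • ν
  let q : ℝ → E := fun t => t⁻¹ • (pr (x t) - w₀)
  have hxd : ∀ t : ℝ, 0 < t → infDist (x t) W ≤ t * ‖ν‖ := fun t ht => by
    refine (infDist_le_dist_of_mem hw₀).trans_eq ?_
    simp [x, dist_eq_norm, norm_smul, abs_of_pos ht]
  have hsmall : ∀ᶠ t in 𝓝[>] (0 : ℝ), 0 < t ∧ t * ‖ν‖ < ε₀ / 2 := by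
    have h1 : Tendsto (fun t : ℝ => t * ‖ν‖) (𝓝[>] 0) (𝓝 0) := by
      have : Continuous fun t : ℝ => t * ‖ν‖ := by fun_prop
      simpa using (this.tendsto 0).mono_left nhdsWithin_le_nhds
    have h2 : ∀ᶠ t : ℝ in 𝓝[>] 0, 0 < t := self_mem_nhdsWithin
    exact h2.and (h1.eventually (gt_mem_nhds (half_pos hε₀)))
  have hpq : ∀ t : ℝ, 0 < t → pr (x t) = w₀ + t • q t := fun t ht => by
    simp [q, smul_inv_smul₀ ht.ne']
  have hq2 : ∀ᶠ t in 𝓝[>] (0 : ℝ), ‖q t‖ ≤ 2 * ‖ν‖ := by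
    filter_upwards [hsmall] with t ⟨ht, htε⟩
    have h1 := (hW (x t) (by linarith [hxd t ht])).2
    have h2 : ‖pr (x t) - w₀‖ ≤ 2 * (t * ‖ν‖) := by
      calc ‖pr (x t) - w₀‖ = dist (pr (x t)) w₀ := (dist_eq_norm _ _).symm
        _ ≤ dist (pr (x t)) (x t) + dist (x t) w₀ := dist_triangle _ _ _
        _ ≤ t * ‖ν‖ + t * ‖ν‖ := by
          refine add_le_add ?_ ?_
          · rw [dist_comm, h1]; exact hxd t ht
          · simp [x, dist_eq_norm, norm_smul, abs_of_pos ht]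
        _ = _ := by ring
    rw [norm_smul, norm_inv, Real.norm_of_nonneg ht.le, inv_mul_le_iff₀ ht]
    linarith
  have hptend : Tendsto (fun t => pr (x t)) (𝓝[>] 0) (𝓝[W] w₀) := by
    refine tendsto_nhdsWithin_iff.2 ⟨?_, ?_⟩
    · rw [tendsto_iff_norm_sub_tendsto_zero]
      have h1 : Tendsto (fun t : ℝ => t * (2 * ‖ν‖)) (𝓝[>] 0) (𝓝 0) := by
        have : Continuous fun t : ℝ => t * (2 * ‖ν‖) := by fun_prop
        simpa using (this.tendsto 0).mono_left nhdsWithin_le_nhds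
      refine squeeze_zero' (.of_forall fun _ => norm_nonneg _) ?_ h1
      filter_upwards [hsmall, hq2] with t ⟨ht, _⟩ h2
      rw [hpq t ht, add_sub_cancel_left, norm_smul, Real.norm_of_nonneg ht.le]
      gcongr
    · filter_upwards [hsmall] with t ⟨ht, htε⟩
      exact (hW (x t) (by linarith [hxd t ht])).1
  have hfed : ∀ᶠ t in 𝓝[>] (0 : ℝ), ∀ w ∈ W,
      ε₀ * ⟪w - pr (x t), ν - q t⟫ ≤ ‖w - pr (x t)‖ ^ 2 * ‖ν‖ := by
    filter_upwards [hsmall] with t ⟨ht, htε⟩ w hw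
    have h1 := reach_inner_le hc hW (x := x t) (by linarith [hxd t ht]) hw
    have h2 : x t - pr (x t) = t • (ν - q t) := by
      rw [hpq t ht, smul_sub]; simp [x]
    rw [h2, real_inner_smul_right] at h1
    have h3 : ‖w - pr (x t)‖ ^ 2 * infDist (x t) W ≤ ‖w - pr (x t)‖ ^ 2 * (t * ‖ν‖) := by
      gcongr; exact hxd t ht
    refine le_of_mul_le_mul_left ?_ ht
    linarith
  have hqsq : ∀ᶠ t in 𝓝[>] (0 : ℝ), ‖q t‖ ^ 2 ≤ 2 * ⟪q t, ν⟫ := by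
    filter_upwards [hsmall, hfed] with t ⟨ht, htε⟩ h1
    have h2 := h1 w₀ hw₀
    rw [hpq t ht, sub_add_cancel_left, norm_neg, norm_smul, inner_neg_left, real_inner_smul_left,
      inner_sub_right, real_inner_self_eq_norm_sq, Real.norm_of_nonneg ht.le] at h2
    have h3 : ε₀ * (‖q t‖ ^ 2 - ⟪q t, ν⟫) ≤ ‖q t‖ ^ 2 * (t * ‖ν‖) := by
      refine le_of_mul_le_mul_left ?_ ht
      linarith
    have h4 : ‖q t‖ ^ 2 * (t * ‖ν‖) ≤ ‖q t‖ ^ 2 * (ε₀ / 2) := by gcongr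
    nlinarith
  have hin0 : Tendsto (fun t => ⟪q t, ν⟫) (𝓝[>] 0) (𝓝 0) := by
    have h1 := hν.comp_tendsto hptend
    rw [Metric.tendsto_nhds]
    intro δ hδ
    have h2 := h1.bound (show 0 < δ / (2 * ‖ν‖ + 1) by positivity)
    filter_upwards [hsmall, hq2, h2] with t ⟨ht, _⟩ h3 h4
    simp only [Function.comp_apply, hpq t ht, add_sub_cancel_left, real_inner_smul_left, norm_smul,
      norm_mul] at h4
    rw [Real.norm_of_nonneg ht.le] at h4
    rw [dist_zero_right]
    have h5 : ‖⟪q t, ν⟫‖ ≤ δ / (2 * ‖ν‖ + 1) * ‖q t‖ := by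
      refine le_of_mul_le_mul_left ?_ ht
      linarith
    calc ‖⟪q t, ν⟫‖ ≤ δ / (2 * ‖ν‖ + 1) * ‖q t‖ := h5
      _ ≤ δ / (2 * ‖ν‖ + 1) * (2 * ‖ν‖) := by gcongr
      _ < δ := by
        rw [div_mul_eq_mul_div, div_lt_iff₀ (by positivity)]
        nlinarith
  have hq0 : Tendsto q (𝓝[>] 0) (𝓝 0) := by
    rw [tendsto_zero_iff_norm_tendsto_zero]
    have h1 : Tendsto (fun t => ‖q t‖ ^ 2) (𝓝[>] 0) (𝓝 0) :=
      squeeze_zero' (.of_forall fun _ => by positivity) hqsq (by simpa using hin0.const_mul 2)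
    have h2 := h1.sqrt
    simpa [Real.sqrt_sq] using h2
  have hp := tendsto_nhds_of_tendsto_nhdsWithin hptend
  have hwp : Tendsto (fun t => w - pr (x t)) (𝓝[>] 0) (𝓝 (w - w₀)) := tendsto_const_nhds.sub hp
  have hl : Tendsto (fun t => ε₀ * ⟪w - pr (x t), ν - q t⟫) (𝓝[>] 0) (𝓝 (ε₀ * ⟪w - w₀, ν⟫)) := by
    have := (hwp.inner (𝕜 := ℝ) ((tendsto_const_nhds (x := ν)).sub hq0)).const_mul ε₀
    simpa using this
  have hr : Tendsto (fun t => ‖w - pr (x t)‖ ^ 2 * ‖ν‖) (𝓝[>] 0) (𝓝 (‖w - w₀‖ ^ 2 * ‖ν‖)) :=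
    (hwp.norm.pow 2).mul_const _
  exact le_of_tendsto_of_tendsto hl hr (hfed.mono fun t ht => ht w hw)

end Reach
section Area

open Filter
open scoped RealInnerProductSpace

variable {n : ℕ}

/-- On a uniformly flat zero set, the defining function is almost linear to second order. -/
lemma UniformlyFlatWith.norm_fderiv_sub_le {ε₀ : ℝ} {T : En n → ℂ} (hT : Differentiable ℂ T)
    (hflat : UniformlyFlatWith ε₀ (T ⁻¹' {0})) {w₀ w : En n} (hw₀ : T w₀ = 0) (hw : T w = 0) :
    ε₀ * ‖fderiv ℂ T w₀ (w - w₀)‖ ≤ ‖w - w₀‖ ^ 2 * ‖fderiv ℂ T w₀‖ := by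
  obtain ⟨hε₀, pr, hpr, hW⟩ := hflat
  set c := fderiv ℂ T w₀ (w - w₀) with hc
  rcases eq_or_ne c 0 with h0 | h0
  · rw [h0, norm_zero, mul_zero]; positivity
  let l : ℂ := (starRingEnd ℂ) c / ‖c‖
  have hl : ‖l‖ = 1 := by
    simp only [l, norm_div, RCLike.norm_conj, Complex.norm_real, norm_norm]
    exact div_self (norm_ne_zero_iff.2 h0)
  let ℓ : En n →L[ℝ] ℝ := Complex.reCLM.comp ((l • fderiv ℂ T w₀).restrictScalars ℝ)
  have hℓ : ∀ v, ℓ v = (l * fderiv ℂ T w₀ v).re := fun v => rfl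
  have hℓn : ∀ v, |ℓ v| ≤ ‖fderiv ℂ T w₀ v‖ := fun v => by
    rw [hℓ]
    refine (Complex.abs_re_le_norm _).trans ?_
    rw [norm_mul, hl, one_mul]
  have hℓc : ℓ (w - w₀) = ‖c‖ := by
    rw [hℓ, ← hc]
    have : l * c = ((‖c‖ : ℝ) : ℂ) := by
      have h1 : ((‖c‖ : ℝ) : ℂ) ≠ 0 := by exact_mod_cast norm_ne_zero_iff.2 h0
      simp only [l]
      rw [div_mul_eq_mul_div, Complex.conj_mul', sq, mul_div_assoc, div_self h1, mul_one]
    rw [this, Complex.ofReal_re]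
  let ν : En n := (InnerProductSpace.toDual ℝ (En n)).symm ℓ
  have hν : ∀ v, ⟪v, ν⟫ = ℓ v := fun v => by
    rw [real_inner_comm]; exact InnerProductSpace.toDual_symm_apply
  have hνn : ‖ν‖ ≤ ‖fderiv ℂ T w₀‖ := by
    rw [LinearIsometryEquiv.norm_map]
    refine ContinuousLinearMap.opNorm_le_bound _ (norm_nonneg _) fun v => ?_
    exact (hℓn v).trans ((fderiv ℂ T w₀).le_opNorm v)
  have ho : (fun v => ⟪v - w₀, ν⟫) =o[𝓝[T ⁻¹' {0}] w₀] fun v => v - w₀ := by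
    have h1 := ((hT w₀).hasFDerivAt.isLittleO).mono (nhdsWithin_le_nhds (s := T ⁻¹' {0}))
    refine Asymptotics.IsBigO.trans_isLittleO (Asymptotics.IsBigO.of_bound 1 ?_) h1
    filter_upwards [self_mem_nhdsWithin] with v hv
    have hv' : T v = 0 := hv
    rw [hν, hv', hw₀, one_mul, sub_zero, zero_sub, norm_neg]
    exact hℓn _
  have h1 := reach_inner_normal_le hε₀ hpr.continuousOn
    (fun z hz => ⟨(hW z hz).1, (hW z hz).2.1⟩) (show w₀ ∈ T ⁻¹' {0} from hw₀) ho
    (show w ∈ T ⁻¹' {0} from hw)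
  rw [hν, hℓc] at h1
  exact h1.trans (by gcongr)

lemma En.sum_smul_single (v : En n) : ∑ j, v j • EuclideanSpace.single j (1 : ℂ) = v := by
  ext k
  simp [Finset.sum_apply, Pi.single_apply]

/-- Forgetting the `i`-th coordinate. -/
def forgetCoord (i : Fin n) (v : En n) : {j : Fin n // j ≠ i} → ℂ := fun j => v j

lemma forgetCoord_sub (i : Fin n) (u v : En n) :
    forgetCoord i (u - v) = forgetCoord i u - forgetCoord i v := rfl

lemma norm_forgetCoord_le (i : Fin n) (v : En n) : ‖forgetCoord i v‖ ≤ ‖v‖ :=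
  (pi_norm_le_iff_of_nonneg (norm_nonneg _)).2 fun j => PiLp.norm_apply_le v j

lemma sum_erase_norm_le (i : Fin n) (v : En n) :
    ∑ j ∈ Finset.univ.erase i, ‖v j‖ ≤ n * ‖forgetCoord i v‖ := by
  have h1 : ∑ j ∈ Finset.univ.erase i, ‖v j‖
      ≤ ∑ _j ∈ Finset.univ.erase i, ‖forgetCoord i v‖ :=
    Finset.sum_le_sum fun j hj =>
      norm_le_pi_norm (forgetCoord i v) ⟨j, (Finset.mem_erase.1 hj).1⟩
  refine h1.trans ?_
  rw [Finset.sum_const, nsmul_eq_mul]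
  gcongr
  simp

/-- Where the `i`-th partial derivative dominates, nearby points of a uniformly flat zero set are
separated by the remaining coordinates. -/
lemma UniformlyFlatWith.norm_sub_le_forgetCoord {ε₀ : ℝ} {T : En n → ℂ}
    (hT : Differentiable ℂ T) (hflat : UniformlyFlatWith ε₀ (T ⁻¹' {0})) {w₀ w : En n}
    (hw₀ : T w₀ = 0) (hw : T w = 0) (hd : fderiv ℂ T w₀ ≠ 0) {i : Fin n}
    (hi : ∀ j, ‖fderiv ℂ T w₀ (EuclideanSpace.single j 1)‖
      ≤ ‖fderiv ℂ T w₀ (EuclideanSpace.single i 1)‖)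
    (hclose : 2 * n * ‖w - w₀‖ ≤ ε₀) :
    ‖w - w₀‖ ≤ 4 * n * ‖forgetCoord i (w - w₀)‖ := by
  have hε₀ := hflat.1
  set a : Fin n → ℂ := fun j => fderiv ℂ T w₀ (EuclideanSpace.single j 1) with ha
  set v := w - w₀ with hv
  set S := ∑ j ∈ Finset.univ.erase i, ‖v j‖ with hS
  have hexp : ∀ u : En n, fderiv ℂ T w₀ u = ∑ j, u j * a j := fun u => by
    conv_lhs => rw [← En.sum_smul_single u]
    simp [ha]
  have hnorm : ‖fderiv ℂ T w₀‖ ≤ n * ‖a i‖ := by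
    refine ContinuousLinearMap.opNorm_le_bound _ (by positivity) fun u => ?_
    rw [hexp]
    refine (norm_sum_le _ _).trans ?_
    calc ∑ j, ‖u j * a j‖ ≤ ∑ _j : Fin n, ‖u‖ * ‖a i‖ := by
          refine Finset.sum_le_sum fun j _ => ?_
          rw [norm_mul]
          exact mul_le_mul (PiLp.norm_apply_le u j) (hi j) (norm_nonneg _) (norm_nonneg _)
      _ = n * ‖a i‖ * ‖u‖ := by simp; ring
  have hai : 0 < ‖a i‖ := by
    rcases (norm_nonneg (a i)).eq_or_lt with h | h
    · rw [← h, mul_zero] at hnorm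
      exact absurd (norm_le_zero_iff.1 hnorm) hd
    · exact h
  have h1 : ‖a i‖ * ‖v i‖ ≤ ‖fderiv ℂ T w₀ v‖ + ‖a i‖ * S := by
    have h2 : v i * a i = fderiv ℂ T w₀ v - ∑ j ∈ Finset.univ.erase i, v j * a j := by
      rw [hexp, ← Finset.add_sum_erase _ _ (Finset.mem_univ i), add_sub_cancel_right]
    rw [← norm_mul, mul_comm, h2]
    refine (norm_sub_le _ _).trans ?_
    gcongr
    refine (norm_sum_le _ _).trans ?_
    rw [hS, Finset.mul_sum]
    refine Finset.sum_le_sum fun j _ => ?_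
    rw [norm_mul, mul_comm]
    gcongr
    exact hi j
  have h3 : ‖fderiv ℂ T w₀ v‖ ≤ ‖a i‖ * (‖v‖ / 2) := by
    have h4 := hflat.norm_fderiv_sub_le hT hw₀ hw
    rw [← hv] at h4
    have h5 : ‖v‖ ^ 2 * ‖fderiv ℂ T w₀‖ ≤ ‖v‖ ^ 2 * (n * ‖a i‖) := by gcongr
    have h6 : ‖v‖ * ‖a i‖ * (2 * n * ‖v‖) ≤ ‖v‖ * ‖a i‖ * ε₀ := by gcongr
    refine le_of_mul_le_mul_left ?_ hε₀
    nlinarith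
  have h7 : ‖v i‖ ≤ ‖v‖ / 2 + S := by
    refine le_of_mul_le_mul_left ?_ hai
    linarith
  have h8 : ‖v‖ ≤ ‖v i‖ + S := by
    conv_lhs => rw [← En.sum_smul_single v]
    refine (norm_sum_le _ _).trans_eq ?_
    rw [hS, Finset.add_sum_erase _ (fun j => ‖v j‖) (Finset.mem_univ i)]
    simp [norm_smul]
  have h9 := sum_erase_norm_le i v
  linarith

lemma finrank_forgetCoord (i : Fin n) :
    Module.finrank ℝ ({j : Fin n // j ≠ i} → ℂ) = 2 * (n - 1) := by
  rw [finrank_real_of_complex, Module.finrank_fintype_fun_eq_card]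
  simp [Fintype.card_subtype_compl]

/-- Hausdorff measure of a set which is a Lipschitz graph over the coordinates other than `i`. -/
lemma hausdorffMeasure_le_of_forgetCoord (hn : 1 ≤ n) (i : Fin n) {A : Set (En n)} {K : ℝ≥0}
    (hA : ∀ u ∈ A, ∀ v ∈ A, ‖u - v‖ ≤ K * ‖forgetCoord i (u - v)‖) {y : En n} {δ : ℝ}
    (hAy : A ⊆ ball y δ) :
    μH[(2 * n - 2 : ℝ)] A ≤ (K : ℝ≥0∞) ^ (2 * n - 2 : ℝ) *
      μH[(Module.finrank ℝ ({j : Fin n // j ≠ i} → ℂ) : ℝ)]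
        (closedBall (0 : {j : Fin n // j ≠ i} → ℂ) δ) := by
  have hdim : (2 * n - 2 : ℝ) = (Module.finrank ℝ ({j : Fin n // j ≠ i} → ℂ) : ℝ) := by
    rw [finrank_forgetCoord]; push_cast [hn]; ring
  rw [hdim]
  have hf : AntilipschitzWith K fun u : A => forgetCoord i (u : En n) := by
    refine AntilipschitzWith.of_le_mul_dist fun u v => ?_
    rw [Subtype.dist_eq, dist_eq_norm, dist_eq_norm, ← forgetCoord_sub]
    exact hA u u.2 v v.2
  have h1 := hf.le_hausdorffMeasure_image
    (d := (Module.finrank ℝ ({j : Fin n // j ≠ i} → ℂ) : ℝ)) (by positivity) univ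
  have h2 : μH[(Module.finrank ℝ ({j : Fin n // j ≠ i} → ℂ) : ℝ)] (univ : Set A)
      = μH[(Module.finrank ℝ ({j : Fin n // j ≠ i} → ℂ) : ℝ)] A := by
    have := (isometry_subtype_coe (s := A)).hausdorffMeasure_image
      (d := (Module.finrank ℝ ({j : Fin n // j ≠ i} → ℂ) : ℝ)) (.inl (by positivity)) univ
    rw [← this, image_univ, Subtype.range_coe]
  rw [h2] at h1
  refine h1.trans ?_
  refine mul_le_mul' le_rfl ?_
  rw [← Measure.addHaar_closedBall_center _ (forgetCoord i y)]
  refine measure_mono ?_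
  rintro _ ⟨u, -, rfl⟩
  rw [mem_closedBall, dist_eq_norm, ← forgetCoord_sub]
  refine (norm_forgetCoord_le _ _).trans ?_
  rw [← dist_eq_norm]
  exact (mem_ball.1 (hAy u.2)).le

/-- The area of a uniformly flat hypersurface in balls of fixed radius is uniformly bounded. -/
lemma exists_surf_ball_le (hn : 1 ≤ n) {T : En n → ℂ} (hT : Differentiable ℂ T)
    (hdT : ∀ z, T z = 0 → fderiv ℂ T z ≠ 0) (hflat : UniformlyFlat (T ⁻¹' {0})) (r : ℝ) :
    ∃ C : ℝ≥0∞, C ≠ ⊤ ∧ ∀ z, surf n (T ⁻¹' {0}) (ball z r) ≤ C := by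
  obtain ⟨ε₀, hflat⟩ := hflat
  have hε₀ := hflat.1
  have hn0 : (0 : ℝ) < n := by exact_mod_cast hn
  set δ : ℝ := ε₀ / (4 * n) with hδ
  have hδ0 : 0 < δ := by positivity
  obtain ⟨t, -, htf, ht⟩ := finite_cover_balls_of_compact
    (isCompact_closedBall (0 : En n) r) hδ0
  let V : Fin n → Set (En n) := fun i => {w | T w = 0 ∧
    ∀ j, ‖fderiv ℂ T w (EuclideanSpace.single j 1)‖
      ≤ ‖fderiv ℂ T w (EuclideanSpace.single i 1)‖}
  let D : Fin n → ℝ≥0∞ := fun i => ((4 * n : ℝ≥0) : ℝ≥0∞) ^ (2 * n - 2 : ℝ) *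
      μH[(Module.finrank ℝ ({j : Fin n // j ≠ i} → ℂ) : ℝ)]
        (closedBall (0 : {j : Fin n // j ≠ i} → ℂ) δ)
  have hD : ∀ i, D i ≠ ⊤ := fun i =>
    ENNReal.mul_ne_top (ENNReal.rpow_ne_top_of_nonneg
      (by have : (1 : ℝ) ≤ n := by exact_mod_cast hn
          linarith) ENNReal.coe_ne_top) measure_closedBall_lt_top.ne
  have hV : ∀ i y, μH[(2 * n - 2 : ℝ)] (V i ∩ ball y δ) ≤ D i := fun i y => by
    refine hausdorffMeasure_le_of_forgetCoord hn i (fun u hu v hv => ?_) inter_subset_right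
    have huv : dist u v < 2 * δ := by
      have h1 := mem_ball.1 hu.2
      have h2 := mem_ball'.1 hv.2
      linarith [dist_triangle u y v]
    push_cast
    refine hflat.norm_sub_le_forgetCoord hT hv.1.1 hu.1.1 (hdT v hv.1.1) hv.1.2 ?_
    rw [← dist_eq_norm]
    calc 2 * n * dist u v ≤ 2 * n * (2 * δ) := by gcongr
      _ = ε₀ := by rw [hδ]; field_simp; norm_num
  have hcover : ∀ z, ball z r ∩ T ⁻¹' {0} ⊆
      ⋃ y ∈ htf.toFinset, ⋃ i ∈ (Finset.univ : Finset (Fin n)), V i ∩ ball (z + y) δ := by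
    rintro z w ⟨hw1, hw2⟩
    have h1 : w - z ∈ closedBall (0 : En n) r := by
      rw [mem_closedBall, dist_zero_right, ← dist_eq_norm]; exact (mem_ball.1 hw1).le
    obtain ⟨y, hy, hwy⟩ := mem_iUnion₂.1 (ht h1)
    have : Nonempty (Fin n) := ⟨⟨0, hn⟩⟩
    obtain ⟨i, hi⟩ := Finite.exists_max
      fun j => ‖fderiv ℂ T w (EuclideanSpace.single j 1)‖
    simp only [mem_iUnion]
    refine ⟨y, by simpa using hy, i, Finset.mem_univ i, ⟨hw2, hi⟩, ?_⟩
    rw [mem_ball, dist_eq_norm] at hwy ⊢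
    rwa [← sub_sub]
  refine ⟨((2 : ℝ≥0∞) ^ (n - 1) * (Nat.factorial (n - 1) : ℝ≥0∞)) *
    ∑ _y ∈ htf.toFinset, ∑ i, D i, ?_, fun z => ?_⟩
  · refine ENNReal.mul_ne_top (ENNReal.mul_ne_top (by simp) (by simp)) ?_
    exact ENNReal.sum_ne_top.2 fun _ _ => ENNReal.sum_ne_top.2 fun i _ => hD i
  · rw [surf, Measure.smul_apply, smul_eq_mul, Measure.restrict_apply measurableSet_ball]
    gcongr
    refine (measure_mono (hcover z)).trans ?_
    refine (measure_biUnion_finset_le _ _).trans ?_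
    refine Finset.sum_le_sum fun y _ => ?_
    refine (measure_biUnion_finset_le _ _).trans ?_
    exact Finset.sum_le_sum fun i _ => hV i _

end Area

section Singularity

variable {n : ℕ}

lemma finrank_En (n : ℕ) : Module.finrank ℝ (En n) = 2 * n := by
  simpa using finrank_real_of_complex (En n)

lemma isAddHaarMeasure_vol (n : ℕ) : (vol n).IsAddHaarMeasure := by
  have h := isAddHaarMeasure_hausdorffMeasure (E := En n)
  rw [finrank_En] at h
  push_cast at h
  exact h

lemma newton_eq (hn : 1 ≤ n) (z ζ : En n) :
    newton n z ζ = -(Real.pi ^ n * 2 ^ n * ((n : ℝ) - 1))⁻¹ * (‖z - ζ‖ ^ (2 * (n - 1)))⁻¹ := by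
  have h : (2 : ℝ) - 2 * n = -((2 * (n - 1) : ℕ) : ℝ) := by
    push_cast [hn]; ring
  rw [newton, h, Real.rpow_neg (norm_nonneg _), Real.rpow_natCast]

lemma newton_const_nonneg (hn : 1 ≤ n) :
    0 ≤ (Real.pi ^ n * 2 ^ n * ((n : ℝ) - 1))⁻¹ := by
  have : (0 : ℝ) ≤ n - 1 := sub_nonneg.2 (by exact_mod_cast hn)
  positivity

lemma newton_nonpos (hn : 1 ≤ n) (z ζ : En n) : newton n z ζ ≤ 0 := by
  rw [newton_eq hn, neg_mul]
  exact neg_nonpos.2 (mul_nonneg (newton_const_nonneg hn) (by positivity))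

lemma GammaR_nonpos (hn : 1 ≤ n) {r : ℝ} (hr : 0 < r) {z ζ : En n} (hz : z ≠ ζ) :
    GammaR n r z ζ ≤ 0 := by
  have := isAddHaarMeasure_vol n
  have h := average_kernel_ball_le (vol n) (n - 1) (by rw [finrank_En]; omega) hz hr
  simp only [GammaR, newton_eq hn, integral_const_mul]
  have h2 := mul_le_mul_of_nonneg_left h (newton_const_nonneg hn)
  rw [Measure.real] at h2
  linarith

lemma newton_le_GammaR (hn : 1 ≤ n) (r : ℝ) (z ζ : En n) : newton n z ζ ≤ GammaR n r z ζ := by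
  rw [GammaR, le_sub_self_iff]
  exact mul_nonpos_of_nonneg_of_nonpos (by positivity)
    (integral_nonpos fun x => newton_nonpos hn ζ x)

lemma surf_singleton (hn : 2 ≤ n) (W : Set (En n)) (z : En n) : surf n W {z} = 0 := by
  have : NullSingletonClass (μH[(2 * n - 2 : ℝ)] : Measure (En n)) := by
    refine Measure.nullSingletonClass_hausdorff _ ?_
    have : (2 : ℝ) ≤ n := by exact_mod_cast hn
    linarith
  simp [surf]

lemma singR_nonpos (hn : 2 ≤ n) (W : Set (En n)) {r : ℝ} (hr : 0 < r) (z : En n) :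
    singR n W r z ≤ 0 := by
  refine mul_nonpos_of_nonneg_of_nonpos Real.pi_pos.le (integral_nonpos_of_ae ?_)
  refine ae_restrict_of_ae ?_
  filter_upwards [compl_mem_ae_iff.2 (surf_singleton hn W z)] with ζ hζ
  exact GammaR_nonpos (by omega) hr (Ne.symm hζ)

lemma le_singR (hn : 1 ≤ n) {W : Set (En n)} (hW : IsClosed W) {r : ℝ} {C : ℝ≥0∞} (hC : C ≠ ⊤)
    {z : En n} (hz : surf n W (ball z r) ≤ C) {ε : ℝ} (hε : 0 < ε) (hzW : ε ≤ infDist z W) :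
    -(Real.pi * ((Real.pi ^ n * 2 ^ n * ((n : ℝ) - 1))⁻¹ * (ε ^ (2 * (n - 1)))⁻¹ * C.toReal))
      ≤ singR n W r z := by
  set M := (Real.pi ^ n * 2 ^ n * ((n : ℝ) - 1))⁻¹ * (ε ^ (2 * (n - 1)))⁻¹ with hM
  have hc := newton_const_nonneg hn
  have hM0 : 0 ≤ M := by positivity
  rw [singR, ← mul_neg]
  refine mul_le_mul_of_nonneg_left ?_ Real.pi_pos.le
  by_cases hi : IntegrableOn (GammaR n r z) (ball z r) (surf n W)
  swap
  · rw [integral_undef hi]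
    exact neg_nonpos.2 (by positivity)
  have hae : ∀ᵐ ζ ∂(surf n W).restrict (ball z r), -M ≤ GammaR n r z ζ := by
    refine ae_restrict_of_ae (Measure.ae_smul_measure ?_ _)
    filter_upwards [ae_restrict_mem hW.measurableSet] with ζ hζ
    refine le_trans ?_ (newton_le_GammaR hn r z ζ)
    have h1 : ε ≤ ‖z - ζ‖ := by
      rw [← dist_eq_norm]; exact hzW.trans (infDist_le_dist_of_mem hζ)
    rw [newton_eq hn, hM, neg_mul, neg_le_neg_iff]
    gcongr
  have hfin : surf n W (ball z r) < ⊤ := hz.trans_lt hC.lt_top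
  calc -(M * C.toReal) ≤ -(M * (surf n W (ball z r)).toReal) := by
        gcongr
    _ = ∫ _ζ in ball z r, -M ∂(surf n W) := by
        rw [setIntegral_const, smul_eq_mul, Measure.real]; ring
    _ ≤ _ := integral_mono_ae (integrableOn_const hfin.ne) hi hae

end Singularity

/-- **Lemma (properties of the singularity).**  For `n ≥ 2`, a uniformly flat smooth
closed complex hypersurface `W = T⁻¹(0)` and `r > 0`: (1) `s_r ≤ 0` everywhere, and
(2) for every `ε > 0` there is `C_{r,ε} > 0` with `s_r(z) ≥ -C_{r,ε}` whenever
`dist(z,W) ≥ ε`. -/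
theorem singularity_nonpositive_and_bounded
    (n : ℕ) (hn : 2 ≤ n) (T : En n → ℂ) (hT : Differentiable ℂ T)
    (W : Set (En n)) (hWT : W = T ⁻¹' {0})
    (hdT : ∀ z ∈ W, fderiv ℂ T z ≠ 0)
    (hflat : UniformlyFlat W) (r : ℝ) (hr : 0 < r) :
    (∀ z : En n, singR n W r z ≤ 0) ∧
    (∀ ε > (0 : ℝ), ∃ Crε > (0 : ℝ), ∀ z : En n,
      ε ≤ Metric.infDist z W → -Crε ≤ singR n W r z) := by
  subst hWT
  refine ⟨singR_nonpos hn _ hr, fun ε hε => ?_⟩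
  obtain ⟨C, hC, hCz⟩ := exists_surf_ball_le (by omega) hT hdT hflat r
  have hc := newton_const_nonneg (n := n) (by omega)
  refine ⟨Real.pi * ((Real.pi ^ n * 2 ^ n * ((n : ℝ) - 1))⁻¹ * (ε ^ (2 * (n - 1)))⁻¹ *
    C.toReal) + 1, by positivity, fun z hz => ?_⟩
  have h := le_singR (by omega) (isClosed_singleton.preimage hT.continuous) hC (hCz z) hε hz
  linarith
end
end
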